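/- There exists a dimensional constant C_n > 0 with the following property: if K is a convex body in ℝⁿ with V(K) = V(B) and 𝓔(K) ≤ ε, then δ_H(K − e_{-2}(K), B_r)^{n+1} ≤ (2 n C_n² (C_n + 2)^{n−1} V(B)/α_n) · exp((n+1)ε/(n V(B))) · (1 − exp(−ε/(n V(B)))), for some constant r with 1 ≤ r ≤ exp(ε/(n V(B))), where B_r is the ball of radius r centered at the origin and α_n = n V(B) β(3, n−1)/β(1/2, (n−1)/2) with β the beta integral. -/

import Mathlib

open MeasureTheory Metric Real Set
open scoped Pointwise RealInnerProductSpace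

noncomputable section

/-- The surface measure `dθ` on the unit sphere `S^{n-1}` of `ℝⁿ`
(its total mass is `n·V(B)`). -/
def sphMeasure (n : ℕ) : Measure (Metric.sphere (0 : EuclideanSpace ℝ (Fin n)) 1) :=
  (volume : Measure (EuclideanSpace ℝ (Fin n))).toSphere

/-- `K` is a convex body: compact, convex, with nonempty interior. -/
def IsConvexBody {n : ℕ} (K : Set (EuclideanSpace ℝ (Fin n))) : Prop :=
  IsCompact K ∧ Convex ℝ K ∧ (interior K).Nonempty

/-- The support function of `K`: `s_K(u) = max_{x ∈ K} x·u`. -/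
def supp {n : ℕ} (K : Set (EuclideanSpace ℝ (Fin n))) (u : EuclideanSpace ℝ (Fin n)) : ℝ :=
  sSup ((fun x => ⟪x, u⟫) '' K)

/-- `n`-dimensional Lebesgue measure (volume), as a real number. -/
def vol {n : ℕ} (K : Set (EuclideanSpace ℝ (Fin n))) : ℝ :=
  (volume K).toReal

/-- The closed unit ball `B` of `ℝⁿ`. -/
def unitBall (n : ℕ) : Set (EuclideanSpace ℝ (Fin n)) :=
  Metric.closedBall 0 1

/-- The entropy functional `𝓔(K) = sup_{x ∈ int K} ∫_{S^{n-1}} log (s_K(u) - x·u) dθ`. -/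
def entropy {n : ℕ} (K : Set (EuclideanSpace ℝ (Fin n))) : ℝ :=
  sSup ((fun x => ∫ u, Real.log (supp K u - ⟪x, (u : EuclideanSpace ℝ (Fin n))⟫)
      ∂(sphMeasure n)) '' interior K)

/-- The `p`-entropy functional `𝓔_p(K) = inf_{x ∈ int K} ∫_{S^{n-1}} (s_K(u) - x·u)^p dθ`. -/
def entropyP {n : ℕ} (p : ℝ) (K : Set (EuclideanSpace ℝ (Fin n))) : ℝ :=
  sInf ((fun x => ∫ u, (supp K u - ⟪x, (u : EuclideanSpace ℝ (Fin n))⟫) ^ p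
      ∂(sphMeasure n)) '' interior K)

/-- The Hausdorff distance between convex bodies,
`δ_H(K,L) = sup_{u ∈ S^{n-1}} |s_K(u) - s_L(u)|`. -/
def hdist {n : ℕ} (K L : Set (EuclideanSpace ℝ (Fin n))) : ℝ :=
  ⨆ u : Metric.sphere (0 : EuclideanSpace ℝ (Fin n)) 1, |supp K u - supp L u|

/-- The beta integral `β(a,b) = ∫₀¹ t^(a-1) (1-t)^(b-1) dt`. -/
def betaInt (a b : ℝ) : ℝ :=
  ∫ t in (0:ℝ)..1, t ^ (a - 1) * (1 - t) ^ (b - 1)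

/-- The constant `α_n = n V(B) β(3, n-1) / β(1/2, (n-1)/2)` from Vitale's lemma. -/
def alphaConst (n : ℕ) : ℝ :=
  n * vol (unitBall n) * betaInt 3 ((n : ℝ) - 1) / betaInt (1/2) (((n : ℝ) - 1) / 2)


section P1

lemma bm1_compact {A B : Set ℝ} (hA : IsCompact A) (hB : IsCompact B)
    (hA0 : A.Nonempty) (hB0 : B.Nonempty) :
    volume A + volume B ≤ volume (A + B) := by
  obtain ⟨a, haA, ha⟩ := hA.exists_isGreatest hA0
  obtain ⟨b, hbB, hb⟩ := hB.exists_isLeast hB0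
  have h1 : (fun x => x + b) '' A ∪ (fun x => a + x) '' B ⊆ A + B := by
    rintro x (⟨y, hy, rfl⟩ | ⟨y, hy, rfl⟩)
    · exact Set.add_mem_add hy hbB
    · exact Set.add_mem_add haA hy
  have h2 : volume ((fun x => x + b) '' A) = volume A := by simp
  have h3 : volume ((fun x => a + x) '' B) = volume B := by simp
  have hd : volume ((fun x => x + b) '' A ∩ (fun x => a + x) '' B) = 0 := by
    refine measure_mono_null (t := {a + b}) ?_ (by simp)
    rintro x ⟨⟨y, hy, rfl⟩, ⟨z, hz, hz'⟩⟩
    have := ha hy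
    have := hb hz
    simp only [mem_singleton_iff] at *
    linarith
  have hm : MeasurableSet ((fun x => a + x) '' B) :=
    (hB.image (by fun_prop)).isClosed.measurableSet
  calc volume A + volume B = volume ((fun x => x + b) '' A ∪ (fun x => a + x) '' B) := by
        have := measure_union_add_inter ((fun x => x + b) '' A) hm (μ := volume)
        rw [hd, h2, h3, add_zero] at this
        exact this.symm
    _ ≤ _ := measure_mono h1

lemma bm1 {A B S : Set ℝ} (hA : MeasurableSet A) (hB : MeasurableSet B)
    (hA0 : A.Nonempty) (hB0 : B.Nonempty) (hS : A + B ⊆ S) :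
    volume A + volume B ≤ volume S := by
  obtain ⟨a, ha⟩ := hA0
  obtain ⟨b, hb⟩ := hB0
  rw [hA.measure_eq_iSup_isCompact, hB.measure_eq_iSup_isCompact]
  simp only [iSup_and']
  refine ENNReal.biSup_add_biSup_le' (p := fun K => K ⊆ A ∧ IsCompact K)
    (q := fun K => K ⊆ B ∧ IsCompact K) ⟨∅, by simp⟩ ⟨∅, by simp⟩ ?_
  intro K hK L hL
  calc volume K + volume L ≤ volume (insert a K) + volume (insert b L) := by
        gcongr <;> simp
    _ ≤ volume (insert a K + insert b L) :=
        bm1_compact (hK.2.insert a) (hL.2.insert b) (by simp) (by simp)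
    _ ≤ volume S := measure_mono ((Set.add_subset_add
        (Set.insert_subset ha hK.1) (Set.insert_subset hb hL.1)).trans hS)

lemma ennreal_amgm {x y z : ENNReal} (hz : z ≠ ⊤) (h : x + y ≤ 2 * z) : x * y ≤ z ^ 2 := by
  have hx : x ≠ ⊤ := ne_top_of_le_ne_top (ENNReal.mul_ne_top (by simp) hz) (le_self_add.trans h)
  have hy : y ≠ ⊤ := ne_top_of_le_ne_top (ENNReal.mul_ne_top (by simp) hz) (le_add_self.trans h)
  lift x to NNReal using hx
  lift y to NNReal using hy
  lift z to NNReal using hz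
  norm_cast at *
  have h' : (x:ℝ) + y ≤ 2 * z := by exact_mod_cast h
  have : (x:ℝ) * y ≤ z ^ 2 := by
    nlinarith [sq_nonneg ((x:ℝ) - y), x.2, y.2, z.2]
  exact_mod_cast this

lemma pl_norm {φ ψ H : ℝ → ℝ} (hφ : Measurable φ) (hψ : Measurable ψ) (hH : Measurable H)
    (φ0 : ∀ a, 0 ≤ φ a) (ψ0 : ∀ a, 0 ≤ ψ a) (H0 : ∀ a, 0 ≤ H a)
    (φ1 : ∀ a, φ a ≤ 1) (ψ1 : ∀ a, ψ a ≤ 1)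
    (φs : ∀ t < 1, ∃ a, t < φ a) (ψs : ∀ t < 1, ∃ a, t < ψ a)
    (h : ∀ a b, φ a * ψ b ≤ H ((a + b) / 2) ^ 2) :
    (∫⁻ a, ENNReal.ofReal (φ a)) + (∫⁻ a, ENNReal.ofReal (ψ a))
      ≤ 2 * ∫⁻ a, ENNReal.ofReal (H a) := by
  rw [lintegral_eq_lintegral_meas_lt _ (.of_forall φ0) hφ.aemeasurable,
    lintegral_eq_lintegral_meas_lt _ (.of_forall ψ0) hψ.aemeasurable,
    lintegral_eq_lintegral_meas_lt _ (.of_forall H0) hH.aemeasurable]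
  have anti : ∀ f : ℝ → ℝ, Measurable (fun t => volume {a | t < f a}) := fun f =>
    Antitone.measurable fun s t hst => measure_mono fun x hx => lt_of_le_of_lt hst hx
  rw [← lintegral_add_left (anti φ), ← lintegral_const_mul _ (anti H)]
  refine setLIntegral_mono (by fun_prop (disch := exact anti H)) ?_
  intro t ht
  by_cases ht1 : t < 1
  · have e : (2 : ENNReal) * volume {a | t < H a} = volume ((2:ℝ) • {a | t < H a}) := by
      rw [Measure.addHaar_smul]; simp
    rw [e]
    refine bm1 (measurableSet_lt measurable_const hφ) (measurableSet_lt measurable_const hψ)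
      (φs t ht1) (ψs t ht1) ?_
    rintro _ ⟨a, ha, b, hb, rfl⟩
    refine ⟨(a + b) / 2, ?_, by simp; ring⟩
    simp only [mem_ofPred_eq] at *
    have := h a b
    have ht0 : 0 < t := ht
    have h2 : t * t < φ a * ψ b := mul_lt_mul'' ha hb ht0.le ht0.le
    have : t ^ 2 < H ((a+b)/2) ^ 2 := by nlinarith
    exact lt_of_pow_lt_pow_left₀ 2 (H0 _) this
  · have e1 : {a | t < φ a} = ∅ := by
      ext a; simp; linarith [φ1 a]
    have e2 : {a | t < ψ a} = ∅ := by
      ext a; simp; linarith [ψ1 a]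
    simp [e1, e2]

lemma lintegral_exp_subst (f : ℝ → ENNReal) :
    ∫⁻ s in Ioi (0:ℝ), f s = ∫⁻ a, ENNReal.ofReal (exp a) * f (exp a) := by
  have := lintegral_image_eq_lintegral_abs_deriv_mul (s := univ) (f := Real.exp)
    (f' := Real.exp) MeasurableSet.univ (fun x _ => (Real.hasDerivAt_exp x).hasDerivWithinAt)
    Real.exp_injective.injOn f
  rw [image_univ, Real.range_exp] at this
  rw [this]; simp

lemma half_line {f g : ℝ → ℝ} (hf : Measurable f) (hg : Measurable g)
    (f0 : ∀ s, 0 ≤ f s) (g0 : ∀ s, 0 ≤ g s) {c : ℝ} (hc : 0 < c)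
    (h : ∀ s t, 0 < s → 0 < t → f s * g t ≤ c * exp (-(s * t))) :
    (∫⁻ s in Ioi (0:ℝ), ENNReal.ofReal (f s)) * (∫⁻ t in Ioi (0:ℝ), ENNReal.ofReal (g t))
      ≤ ENNReal.ofReal (c * (π / 2)) := by
  by_cases hf0 : ∀ s, 0 < s → f s = 0
  · have : ∫⁻ s in Ioi (0:ℝ), ENNReal.ofReal (f s) = 0 := by
      rw [setLIntegral_congr_fun measurableSet_Ioi (g := fun _ => 0) fun s hs => by simp [hf0 s hs]]
      simp
    simp [this]
  by_cases hg0 : ∀ s, 0 < s → g s = 0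
  · have : ∫⁻ s in Ioi (0:ℝ), ENNReal.ofReal (g s) = 0 := by
      rw [setLIntegral_congr_fun measurableSet_Ioi (g := fun _ => 0) fun s hs => by simp [hg0 s hs]]
      simp
    simp [this]
  push Not at hf0 hg0
  obtain ⟨s0, hs0, hfs⟩ := hf0
  obtain ⟨t0, ht0, hgt⟩ := hg0
  replace hfs : 0 < f s0 := lt_of_le_of_ne (f0 _) hfs.symm
  replace hgt : 0 < g t0 := lt_of_le_of_ne (g0 _) hgt.symm
  have key : ∀ s t : ℝ, 0 < s → 0 < t → s * exp (-(s*t)) ≤ 1 / t := by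
    intro s t hs ht
    rw [Real.exp_neg, le_div_iff₀ ht, mul_right_comm, ← div_eq_mul_inv, div_le_one (exp_pos _)]
    linarith [Real.add_one_le_exp (s*t)]
  set φ : ℝ → ℝ := fun a => exp a * f (exp a) with hφ
  set ψ : ℝ → ℝ := fun a => exp a * g (exp a) with hψ
  have φ0 : ∀ a, 0 ≤ φ a := fun a => mul_nonneg (exp_pos _).le (f0 _)
  have ψ0 : ∀ a, 0 ≤ ψ a := fun a => mul_nonneg (exp_pos _).le (g0 _)
  have φb : BddAbove (range φ) := by
    refine ⟨c / t0 / g t0, ?_⟩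
    rintro _ ⟨a, rfl⟩
    rw [le_div_iff₀ hgt]
    have h1 := h (exp a) t0 (exp_pos _) ht0
    have h2 := key (exp a) t0 (exp_pos _) ht0
    calc exp a * f (exp a) * g t0 = exp a * (f (exp a) * g t0) := by ring
      _ ≤ exp a * (c * exp (-(exp a * t0))) := by gcongr
      _ = c * (exp a * exp (-(exp a * t0))) := by ring
      _ ≤ c * (1 / t0) := by gcongr
      _ = c / t0 := by ring
  have ψb : BddAbove (range ψ) := by
    refine ⟨c / s0 / f s0, ?_⟩
    rintro _ ⟨a, rfl⟩
    rw [le_div_iff₀ hfs]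
    have h1 := h s0 (exp a) hs0 (exp_pos _)
    have h2 := key (exp a) s0 (exp_pos _) hs0
    calc exp a * g (exp a) * f s0 = exp a * (f s0 * g (exp a)) := by ring
      _ ≤ exp a * (c * exp (-(s0 * exp a))) := by gcongr
      _ = c * (exp a * exp (-(exp a * s0))) := by ring_nf
      _ ≤ c * (1 / s0) := by gcongr
      _ = c / s0 := by ring
  set M := ⨆ a, φ a with hM
  set N := ⨆ a, ψ a with hN
  have Mpos : 0 < M := lt_of_lt_of_le (by simp [hφ, Real.exp_log hs0, hfs, hs0] : 0 < φ (log s0)) (le_ciSup φb _)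
  have Npos : 0 < N := lt_of_lt_of_le (by simp [hψ, Real.exp_log ht0, hgt, ht0] : 0 < ψ (log t0)) (le_ciSup ψb _)
  have hMN : 0 < √(M * N) := Real.sqrt_pos.2 (by positivity)
  set H : ℝ → ℝ := fun w => (√c / √(M*N)) * (exp w * exp (-(exp w)^2 / 2)) with hH
  have main := pl_norm (φ := fun a => φ a / M) (ψ := fun a => ψ a / N) (H := H)
    (by fun_prop) (by fun_prop) (by fun_prop) (fun a => div_nonneg (φ0 a) Mpos.le)
    (fun a => div_nonneg (ψ0 a) Npos.le) (fun a => by positivity)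
    (fun a => (div_le_one Mpos).2 (le_ciSup φb a)) (fun a => (div_le_one Npos).2 (le_ciSup ψb a))
    (fun t ht => by
      obtain ⟨a, ha⟩ := exists_lt_of_lt_ciSup (show t * M < ⨆ a, φ a by
        rw [← hM]; nlinarith)
      exact ⟨a, by rwa [lt_div_iff₀ Mpos]⟩)
    (fun t ht => by
      obtain ⟨a, ha⟩ := exists_lt_of_lt_ciSup (show t * N < ⨆ a, ψ a by
        rw [← hN]; nlinarith)
      exact ⟨a, by rwa [lt_div_iff₀ Npos]⟩)
    (fun a b => by
      have h1 := h (exp a) (exp b) (exp_pos _) (exp_pos _)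
      have e1 : H ((a+b)/2) ^ 2 = (c * (exp a * exp b * exp (-(exp a * exp b)))) / (M * N) := by
        simp only [hH]
        rw [mul_pow, div_pow, Real.sq_sqrt hc.le, Real.sq_sqrt (by positivity), mul_pow]
        have e2 : exp ((a+b)/2) ^ 2 = exp a * exp b := by
          rw [← Real.exp_nat_mul, ← Real.exp_add]; congr 1; push_cast; ring
        rw [e2, ← Real.exp_nat_mul]
        have : ((2:ℕ):ℝ) * (-(exp a * exp b) / 2) = -(exp a * exp b) := by push_cast; ring
        rw [this]; ring
      rw [e1, div_mul_div_comm]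
      refine div_le_div_of_nonneg_right ?_ (by positivity)
      calc φ a * ψ b = exp a * exp b * (f (exp a) * g (exp b)) := by simp only [hφ, hψ]; ring
        _ ≤ exp a * exp b * (c * exp (-(exp a * exp b))) := by gcongr
        _ = c * (exp a * exp b * exp (-(exp a * exp b))) := by ring)
  have eH : ∫⁻ a, ENNReal.ofReal (H a) = ENNReal.ofReal (√c / √(M*N) * √(π/2)) := by
    have h1 : ∀ a, ENNReal.ofReal (H a) = ENNReal.ofReal (exp a) *
        ENNReal.ofReal (√c / √(M*N) * exp (-(1/2) * (exp a)^2)) := by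
      intro a
      rw [← ENNReal.ofReal_mul (exp_pos _).le]
      congr 1; simp only [hH]
      rw [show -(exp a)^2/2 = -(1/2) * (exp a)^2 by ring]; ring
    simp_rw [h1]
    rw [← lintegral_exp_subst (fun s => ENNReal.ofReal (√c / √(M*N) * exp (-(1/2) * s^2))),
      ← ofReal_integral_eq_lintegral_ofReal, integral_const_mul, integral_gaussian_Ioi]
    · congr 2
      rw [show π / (1/2) = 2 * 2 * (π/2) by ring, Real.sqrt_mul (by norm_num),
        Real.sqrt_mul_self (by norm_num)]; ring
    · exact ((integrable_exp_neg_mul_sq (by norm_num)).integrableOn).const_mul _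
    · exact .of_forall fun s => by positivity
  have ef : ∫⁻ s in Ioi (0:ℝ), ENNReal.ofReal (f s)
      = ENNReal.ofReal M * ∫⁻ a, ENNReal.ofReal (φ a / M) := by
    rw [lintegral_exp_subst, ← lintegral_const_mul _ (by fun_prop)]
    congr 1; ext a
    rw [← ENNReal.ofReal_mul (exp_pos _).le, ← ENNReal.ofReal_mul Mpos.le,
      mul_div_cancel₀ _ Mpos.ne']
  have eg : ∫⁻ s in Ioi (0:ℝ), ENNReal.ofReal (g s)
      = ENNReal.ofReal N * ∫⁻ a, ENNReal.ofReal (ψ a / N) := by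
    rw [lintegral_exp_subst, ← lintegral_const_mul _ (by fun_prop)]
    congr 1; ext a
    rw [← ENNReal.ofReal_mul (exp_pos _).le, ← ENNReal.ofReal_mul Npos.le,
      mul_div_cancel₀ _ Npos.ne']
  rw [eH] at main
  have m2 := ennreal_amgm (by simp) main
  rw [ef, eg, mul_mul_mul_comm]
  calc _ ≤ ENNReal.ofReal M * ENNReal.ofReal N * ENNReal.ofReal (√c / √(M*N) * √(π/2)) ^ 2 := by
        gcongr
    _ = _ := by
        rw [← ENNReal.ofReal_mul Mpos.le, ← ENNReal.ofReal_pow (by positivity),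
          ← ENNReal.ofReal_mul (by positivity)]
        congr 1
        rw [mul_pow, div_pow, Real.sq_sqrt hc.le, Real.sq_sqrt (by positivity),
          Real.sq_sqrt (by positivity)]
        field_simp

end P1

section P2

/-- class of densities with all exponential moments -/
def GoodFn (n : ℕ) (f : (Fin n → ℝ) → ℝ) : Prop :=
  Measurable f ∧ (∀ x, 0 ≤ f x) ∧ ∀ z : Fin n → ℝ, Integrable (fun x => exp (dotProduct z x) * f x)

/-- same on a product -/
def GoodPr (n : ℕ) (f : ℝ × (Fin n → ℝ) → ℝ) : Prop :=
  Measurable f ∧ (∀ x, 0 ≤ f x) ∧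
    ∀ (a : ℝ) (z : Fin n → ℝ), Integrable (fun p : ℝ × (Fin n → ℝ) =>
      exp (a * p.1 + dotProduct z p.2) * f p)

def SantP (n : ℕ) : Prop := ∀ f g : (Fin n → ℝ) → ℝ, GoodFn n f → GoodFn n g →
  (∀ x y, f x * g y ≤ exp (-dotProduct x y)) → (∀ i, ∫ x, x i * f x = 0) →
  (∫ x, f x) * (∫ x, g x) ≤ (2 * π) ^ n

def tshear {n : ℕ} (v : Fin n → ℝ) (p : ℝ × (Fin n → ℝ)) : ℝ × (Fin n → ℝ) := (p.1, p.2 + p.1 • v)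
def sshear {n : ℕ} (v : Fin n → ℝ) (p : ℝ × (Fin n → ℝ)) : ℝ × (Fin n → ℝ) :=
  (p.1 - dotProduct v p.2, p.2)

lemma continuous_dot {n : ℕ} (z : Fin n → ℝ) : Continuous (fun x => dotProduct z x) := by
  unfold dotProduct; fun_prop

lemma measurable_dot {n : ℕ} (z : Fin n → ℝ) : Measurable (fun x => dotProduct z x) :=
  (continuous_dot z).measurable

lemma tshear_emb {n : ℕ} (v : Fin n → ℝ) : MeasurableEmbedding (tshear v) := by
  refine Continuous.measurableEmbedding (by unfold tshear; fun_prop) ?_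
  rintro ⟨s, x⟩ ⟨t, y⟩ h
  simp only [tshear, Prod.mk.injEq] at h
  obtain ⟨rfl, h⟩ := h
  simpa using h

lemma sshear_emb {n : ℕ} (v : Fin n → ℝ) : MeasurableEmbedding (sshear v) := by
  refine Continuous.measurableEmbedding ?_ ?_
  · unfold sshear
    exact (continuous_fst.sub ((continuous_dot v).comp continuous_snd)).prodMk continuous_snd
  rintro ⟨s, x⟩ ⟨t, y⟩ h
  simp only [sshear, Prod.mk.injEq] at h
  obtain ⟨h, rfl⟩ := h
  simpa using h

lemma tshear_mp {n : ℕ} (v : Fin n → ℝ) (μ : Measure ℝ) [SFinite μ] :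
    MeasurePreserving (tshear v) (μ.prod volume) (μ.prod volume) := by
  refine MeasurePreserving.skew_product (g := fun s x => x + s • v) (MeasurePreserving.id μ) ?_ ?_
  · unfold Function.uncurry; fun_prop
  · exact .of_forall fun s => map_add_right_eq_self volume _

lemma sshear_mp {n : ℕ} (v : Fin n → ℝ) :
    MeasurePreserving (sshear v) (volume : Measure (ℝ × (Fin n → ℝ))) volume := by
  have h := MeasurePreserving.skew_product (μa := (volume : Measure (Fin n → ℝ)))
    (μc := (volume : Measure ℝ)) (μd := (volume : Measure ℝ))
    (g := fun x s => s - dotProduct v x) (MeasurePreserving.id volume) (by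
      unfold Function.uncurry
      exact measurable_snd.sub ((measurable_dot v).comp measurable_fst)) (by
      exact .of_forall fun s => by
        simpa [sub_eq_add_neg] using! map_add_right_eq_self (volume : Measure ℝ) (-dotProduct v s))
  have h2 := (Measure.measurePreserving_swap (μ := (volume : Measure (Fin n → ℝ)))
    (ν := (volume : Measure ℝ))).comp (h.comp (Measure.measurePreserving_swap
      (μ := (volume : Measure ℝ)) (ν := (volume : Measure (Fin n → ℝ)))))
  exact h2

lemma ioi_restrict (n : ℕ) : (volume : Measure (ℝ × (Fin n → ℝ))).restrict (Ioi 0 ×ˢ univ)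
    = ((volume : Measure ℝ).restrict (Ioi 0)).prod volume := by
  rw [Measure.volume_eq_prod, ← Measure.prod_restrict, Measure.restrict_univ]

lemma half_space {n : ℕ} (hP : SantP n) {f g : ℝ × (Fin n → ℝ) → ℝ} (hf : GoodPr n f)
    (hg : GoodPr n g) (h : ∀ p q, f p * g q ≤ exp (-(p.1 * q.1 + dotProduct p.2 q.2)))
    (v : Fin n → ℝ)
    (hb : ∀ i, ∫ p : ℝ × (Fin n → ℝ) in Ioi (0:ℝ) ×ˢ univ, (p.2 i - p.1 * v i) * f p = 0) :
    (∫ p in Ioi (0:ℝ) ×ˢ univ, f p) * (∫ q in {q : ℝ × (Fin n → ℝ) | 0 < q.1 + dotProduct v q.2}, g q)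
      ≤ (π / 2) * (2 * π) ^ n := by
  set ν : Measure (ℝ × (Fin n → ℝ)) := ((volume : Measure ℝ).restrict (Ioi 0)).prod volume with hν
  rw [ioi_restrict] at *
  obtain ⟨fm, f0, fi⟩ := hf
  obtain ⟨gm, g0, gi⟩ := hg
  have tm : Measurable (tshear v) := (tshear_emb v).measurable
  have sm : Measurable (sshear v) := (sshear_emb v).measurable
  have hpre : sshear v ⁻¹' {q : ℝ × (Fin n → ℝ) | 0 < q.1 + dotProduct v q.2} = Ioi (0:ℝ) ×ˢ univ := by
    ext p; simp [sshear]
  have eg : ∀ k : ℝ × (Fin n → ℝ) → ℝ,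
      ∫ q in {q : ℝ × (Fin n → ℝ) | 0 < q.1 + dotProduct v q.2}, k q = ∫ p, k (sshear v p) ∂ν := by
    intro k
    rw [hν, ← ioi_restrict, ← hpre, (sshear_mp v).setIntegral_preimage_emb (sshear_emb v)]
  have ef : ∀ k : ℝ × (Fin n → ℝ) → ℝ, ∫ p, k (tshear v p) ∂ν = ∫ p, k p ∂ν := fun k =>
    (tshear_mp v _).integral_comp (tshear_emb v) k
  have fint : ∀ (a : ℝ) (z : Fin n → ℝ), Integrable (fun p : ℝ × (Fin n → ℝ) =>
      exp (a * p.1 + dotProduct z p.2) * f (tshear v p)) ν := by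
    intro a z
    have h1 : Integrable (fun p : ℝ × (Fin n → ℝ) =>
      exp ((a - dotProduct z v) * p.1 + dotProduct z p.2) * f p) ν := by
      rw [hν, ← ioi_restrict]; exact (fi _ z).restrict
    have h2 := ((tshear_mp v _).integrable_comp_emb (tshear_emb v)).2 h1
    refine h2.congr (.of_forall fun p => ?_)
    simp only [Function.comp, tshear, dotProduct_add, dotProduct_smul, smul_eq_mul]
    congr 2; ring
  have gint : ∀ (a : ℝ) (z : Fin n → ℝ), Integrable (fun p : ℝ × (Fin n → ℝ) =>
      exp (a * p.1 + dotProduct z p.2) * g (sshear v p)) ν := by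
    intro a z
    have h2 := ((sshear_mp v).integrable_comp_emb (sshear_emb v)).2 (gi a (z + a • v))
    rw [hν, ← ioi_restrict]
    refine (h2.congr (.of_forall fun p => ?_)).restrict
    simp only [Function.comp, sshear, add_dotProduct, smul_dotProduct, smul_eq_mul]
    congr 2; ring
  set F : (Fin n → ℝ) → ℝ := fun x => ∫ s in Ioi (0:ℝ), f (tshear v (s, x)) with hF
  set G : (Fin n → ℝ) → ℝ := fun x => ∫ s in Ioi (0:ℝ), g (sshear v (s, x)) with hG
  have F0 : ∀ x, 0 ≤ F x := fun x => integral_nonneg fun s => f0 _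
  have G0 : ∀ x, 0 ≤ G x := fun x => integral_nonneg fun s => g0 _
  have gen : ∀ k : ℝ × (Fin n → ℝ) → ℝ, Measurable k → (∀ p, 0 ≤ k p) →
      (∀ (a : ℝ) (z : Fin n → ℝ), Integrable (fun p : ℝ × (Fin n → ℝ) =>
        exp (a * p.1 + dotProduct z p.2) * k p) ν) →
      GoodFn n (fun x => ∫ s in Ioi (0:ℝ), k (s, x)) := by
    intro k km k0 ki
    refine ⟨(km.stronglyMeasurable.integral_prod_left').measurable,
      fun x => integral_nonneg fun s => k0 _, fun z => ?_⟩
    have := (ki 0 z).integral_prod_right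
    refine this.congr (.of_forall fun x => ?_)
    simp only [zero_mul, zero_add]
    rw [integral_const_mul]
  have FG : GoodFn n F := gen _ (fm.comp tm) (fun p => f0 _) fint
  have GG : GoodFn n G := gen _ (gm.comp sm) (fun p => g0 _) gint
  have fi0 : Integrable (fun p => f (tshear v p)) ν := by simpa using fint 0 0
  have gi0 : Integrable (fun p => g (sshear v p)) ν := by simpa using gint 0 0
  have IF : ∫ x, F x = ∫ p, f p ∂ν := by
    rw [← ef f, hν, integral_prod_symm _ fi0]
  have IG : ∫ x, G x = ∫ q in {q : ℝ × (Fin n → ℝ) | 0 < q.1 + dotProduct v q.2}, g q := by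
    rw [eg, hν, integral_prod_symm _ gi0]
  have hFG : ∀ x y, F x * G y ≤ exp (-dotProduct x y) * (π / 2) := by
    intro x y
    have f2 : Measurable fun s : ℝ => f (tshear v (s, x)) := fm.comp (tm.comp (by fun_prop))
    have g2 : Measurable fun s : ℝ => g (sshear v (s, y)) := gm.comp (sm.comp (by fun_prop))
    have := half_line f2 g2 (fun _ => f0 _) (fun _ => g0 _) (exp_pos (-dotProduct x y)) (by
      intro s t hs ht
      refine (h _ _).trans (le_of_eq ?_)
      rw [← Real.exp_add]
      simp only [tshear, sshear, add_dotProduct, smul_dotProduct, smul_eq_mul]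
      congr 1; ring)
    simp only [hF, hG]
    rw [integral_eq_lintegral_of_nonneg_ae (.of_forall fun _ => f0 _) f2.aestronglyMeasurable,
      integral_eq_lintegral_of_nonneg_ae (.of_forall fun _ => g0 _) g2.aestronglyMeasurable,
      ← ENNReal.toReal_mul]
    refine ENNReal.toReal_le_of_le_ofReal (by positivity) this
  have key := hP F (fun y => (2 / π) * G y) FG
    ⟨GG.1.const_mul _, fun x => mul_nonneg (by positivity) (G0 x), fun z => by
      refine ((GG.2.2 z).const_mul (2/π)).congr (.of_forall fun x => ?_)
      simp only; ring⟩ (by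
      intro x y
      have := hFG x y
      calc F x * (2 / π * G y) = (2/π) * (F x * G y) := by ring
        _ ≤ (2/π) * (exp (-dotProduct x y) * (π / 2)) := by gcongr
        _ = _ := by field_simp) (by
      intro i
      have hi : Integrable (fun p : ℝ × (Fin n → ℝ) => p.2 i * f (tshear v p)) ν := by
        have h1 := (fint 0 (Pi.single i 1)).add (fint 0 (-Pi.single i 1))
        refine h1.mono' (((measurable_pi_apply i).comp measurable_snd).mul
          (fm.comp tm)).aestronglyMeasurable (.of_forall fun p => ?_)
        simp only [Pi.add_apply, zero_mul, zero_add, neg_dotProduct, single_dotProduct, one_mul,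
          norm_mul, norm_eq_abs, abs_of_nonneg (f0 _), ← add_mul]
        refine mul_le_mul_of_nonneg_right ?_ (f0 _)
        rcases abs_cases (p.2 i) with ⟨h, _⟩ | ⟨h, _⟩ <;> rw [h]
        · linarith [Real.add_one_le_exp (p.2 i), exp_pos (-p.2 i)]
        · linarith [Real.add_one_le_exp (-p.2 i), exp_pos (p.2 i)]
      have e1 : ∫ x, x i * F x = ∫ p, p.2 i * f (tshear v p) ∂ν := by
        rw [hν, integral_prod_symm _ hi]
        simp only [hF, integral_const_mul]
      rw [e1, ← hb i, ← ef (fun p => (p.2 i - p.1 * v i) * f p)]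
      congr 1; ext p; simp [tshear])
  rw [integral_const_mul, IF, IG] at key
  have : (2 / π) * ((∫ p, f p ∂ν) * (∫ q in {q : ℝ × (Fin n → ℝ) | 0 < q.1 + dotProduct v q.2}, g q))
    ≤ (2 * π) ^ n := by linarith [key]
  rw [div_mul_eq_mul_div, div_le_iff₀ pi_pos] at this
  linarith

end P2

section P3

lemma exists_median {φ : ℝ → ℝ} (hφ : Integrable φ) (hpos : 0 < ∫ s, φ s) :
    ∃ m, ∫ s in Ioi m, φ s = (∫ s, φ s) / 2 := by
  set A := ∫ s, φ s
  set L := ∫ s in Iic (0:ℝ), φ s with hL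
  set R := ∫ s in Ioi (0:ℝ), φ s with hR
  have hA : L + R = A := by
    rw [hL, hR, ← compl_Iic]; exact integral_add_compl measurableSet_Iic hφ
  have hc : Continuous fun m => ∫ s in (0:ℝ)..m, φ s :=
    intervalIntegral.continuous_primitive (fun a b => hφ.intervalIntegrable) 0
  have h1 := intervalIntegral_tendsto_integral_Ioi (0:ℝ) hφ.integrableOn Filter.tendsto_id
  have h2 := intervalIntegral_tendsto_integral_Iic (0:ℝ) hφ.integrableOn Filter.tendsto_id
  obtain ⟨b, hb⟩ := (show ∀ᶠ i in Filter.atTop, (R - L)/2 ≤ ∫ x in (0:ℝ)..id i, φ x from h1 (Ici_mem_nhds (show (R - L)/2 < R by linarith))).exists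
  obtain ⟨a, ha⟩ := (show ∀ᶠ i in Filter.atBot, (L - R)/2 ≤ ∫ x in (id i)..0, φ x from h2 (Ici_mem_nhds (show (L - R)/2 < L by linarith))).exists
  obtain ⟨m, hm⟩ := mem_range_of_exists_le_of_exists_ge hc (c := (R - L)/2)
    ⟨a, by rw [intervalIntegral.integral_symm]; simp only [id] at ha; linarith⟩ ⟨b, hb⟩
  refine ⟨m, ?_⟩
  have h3 := intervalIntegral.integral_Iic_sub_Iic (μ := volume) (f := φ) (a := 0) (b := m)
    hφ.integrableOn hφ.integrableOn
  have h4 : (∫ s in Iic m, φ s) + ∫ s in Ioi m, φ s = A := by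
    rw [← compl_Iic]; exact integral_add_compl measurableSet_Iic hφ
  simp only at hm
  linarith

variable {n : ℕ}

lemma abs_le_exp_add (x : ℝ) : |x| ≤ exp x + exp (-x) := by
  rcases abs_cases x with ⟨h, _⟩ | ⟨h, _⟩ <;> rw [h]
  · linarith [Real.add_one_le_exp x, exp_pos (-x)]
  · linarith [Real.add_one_le_exp (-x), exp_pos x]

lemma GoodPr.int {f : ℝ × (Fin n → ℝ) → ℝ} (hf : GoodPr n f) : Integrable f := by
  simpa using hf.2.2 0 0

lemma GoodPr.int1 {f : ℝ × (Fin n → ℝ) → ℝ} (hf : GoodPr n f) :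
    Integrable (fun p : ℝ × (Fin n → ℝ) => p.1 * f p) := by
  have h1 := (hf.2.2 1 0).add (hf.2.2 (-1) 0)
  refine h1.mono' (measurable_fst.mul hf.1).aestronglyMeasurable (.of_forall fun p => ?_)
  simp only [Pi.add_apply, one_mul, zero_dotProduct, add_zero, norm_mul, norm_eq_abs,
    abs_of_nonneg (hf.2.1 p), ← add_mul, neg_mul]
  exact mul_le_mul_of_nonneg_right (abs_le_exp_add _) (hf.2.1 p)

lemma GoodPr.int2 {f : ℝ × (Fin n → ℝ) → ℝ} (hf : GoodPr n f) (i : Fin n) :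
    Integrable (fun p : ℝ × (Fin n → ℝ) => p.2 i * f p) := by
  have h1 := (hf.2.2 0 (Pi.single i 1)).add (hf.2.2 0 (-Pi.single i 1))
  refine h1.mono' (((measurable_pi_apply i).comp measurable_snd).mul hf.1).aestronglyMeasurable
    (.of_forall fun p => ?_)
  simp only [Pi.add_apply, zero_mul, zero_add, neg_dotProduct, single_dotProduct, one_mul,
          norm_mul, norm_eq_abs, abs_of_nonneg (hf.2.1 p), ← add_mul]
  exact mul_le_mul_of_nonneg_right (abs_le_exp_add _) (hf.2.1 p)

def prefl (p : ℝ × (Fin n → ℝ)) : ℝ × (Fin n → ℝ) := (-p.1, p.2)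

lemma prefl_mp : MeasurePreserving (prefl (n := n)) volume volume :=
  (Measure.measurePreserving_neg (volume : Measure ℝ)).prod (MeasurePreserving.id _)

lemma prefl_emb : MeasurableEmbedding (prefl (n := n)) := by
  refine Continuous.measurableEmbedding (by unfold prefl; fun_prop) ?_
  rintro ⟨s, x⟩ ⟨t, y⟩ h
  simpa [prefl] using h

lemma GoodPr.refl {f : ℝ × (Fin n → ℝ) → ℝ} (hf : GoodPr n f) : GoodPr n (fun p => f (prefl p)) := by
  refine ⟨hf.1.comp prefl_emb.measurable, fun _ => hf.2.1 _, fun a z => ?_⟩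
  refine ((prefl_mp.integrable_comp_emb prefl_emb).2 (hf.2.2 (-a) z)).congr (.of_forall fun p => ?_)
  simp [prefl]

instance prod_add_right : (volume : Measure (ℝ × (Fin n → ℝ))).IsAddRightInvariant := by
  have : (volume : Measure (ℝ × (Fin n → ℝ))).IsAddLeftInvariant := by
    rw [Measure.volume_eq_prod]; infer_instance
  infer_instance

lemma GoodPr.shift {f : ℝ × (Fin n → ℝ) → ℝ} (hf : GoodPr n f) (w : ℝ × (Fin n → ℝ)) :
    GoodPr n (fun p => f (p + w)) := by
  refine ⟨hf.1.comp (by fun_prop), fun _ => hf.2.1 _, fun a z => ?_⟩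
  refine (((hf.2.2 a z).comp_add_right w).const_mul
    (exp (-(a * w.1 + dotProduct z w.2)))).congr (.of_forall fun p => ?_)
  simp only [Prod.fst_add, Prod.snd_add, dotProduct_add]
  rw [← mul_assoc, ← Real.exp_add]; congr 2; ring

lemma set_shift (k : ℝ × (Fin n → ℝ) → ℝ) (w : ℝ × (Fin n → ℝ)) (S : Set ℝ) :
    ∫ p in ((fun s => s + w.1) ⁻¹' S) ×ˢ univ, k (p + w) = ∫ p in S ×ˢ univ, k p := by
  have h := (measurePreserving_add_right (volume : Measure (ℝ × (Fin n → ℝ))) w).setIntegral_preimage_emb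
    (MeasurableEquiv.addRight w).measurableEmbedding k (S ×ˢ univ)
  rw [← h]
  rfl

lemma sant_shift (hP : SantP n) {f : ℝ × (Fin n → ℝ) → ℝ} (hf : GoodPr n f) :
    ∃ w : ℝ × (Fin n → ℝ), ∀ g, GoodPr n g →
      (∀ p q, f (p + w) * g q ≤ exp (-(p.1 * q.1 + dotProduct p.2 q.2))) →
      (∫ p, f p) * (∫ p, g p) ≤ (2 * π) ^ (n + 1) := by
  have hA0 : 0 ≤ ∫ p, f p := integral_nonneg hf.2.1
  rcases hA0.eq_or_lt with hA | hA
  · refine ⟨0, fun g _ _ => ?_⟩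
    rw [← hA, zero_mul]; positivity
  set A := ∫ p, f p with hAdef
  obtain ⟨m, hm⟩ := exists_median (φ := fun s => ∫ x, f (s, x)) hf.int.integral_prod_left (by
    rw [← integral_prod _ hf.int]; exact hA)
  rw [← integral_prod _ hf.int] at hm
  have hre : ∀ S : Set ℝ, (volume : Measure (ℝ × (Fin n → ℝ))).restrict (S ×ˢ univ) =
      ((volume : Measure ℝ).restrict S).prod volume := by
    intro S
    rw [Measure.volume_eq_prod, ← Measure.prod_restrict, Measure.restrict_univ]
  have hp : ∫ p in Ioi m ×ˢ (univ : Set (Fin n → ℝ)), f p = A / 2 := by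
    rw [hre, integral_prod, hm]
    · rfl
    · rw [← hre]; exact hf.int.restrict
  have hsplit : ∀ k : ℝ × (Fin n → ℝ) → ℝ, Integrable k →
      (∫ p in Ioi m ×ˢ univ, k p) + (∫ p in Iio m ×ˢ univ, k p) = ∫ p, k p := by
    intro k hk
    have h1 : (∫ p in Iio m ×ˢ univ, k p) = ∫ p in Iic m ×ˢ univ, k p := by
      rw [hre, hre, Measure.restrict_congr_set Iio_ae_eq_Iic]
    rw [h1, ← integral_add_compl ((measurableSet_Ioi (a := m)).prod MeasurableSet.univ) hk]
    congr 3
    ext p; simp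
  have hq : ∫ p in Iio m ×ˢ (univ : Set (Fin n → ℝ)), f p = A / 2 := by
    have := hsplit f hf.int
    rw [hp] at this; linarith
  set Mp : Fin n → ℝ := fun i => ∫ p : ℝ × (Fin n → ℝ) in Ioi m ×ˢ univ, p.2 i * f p with hMp
  set Mm : Fin n → ℝ := fun i => ∫ p : ℝ × (Fin n → ℝ) in Iio m ×ˢ univ, p.2 i * f p with hMm
  set Sp : ℝ := ∫ p : ℝ × (Fin n → ℝ) in Ioi m ×ˢ univ, (p.1 - m) * f p with hSp
  set Sm : ℝ := ∫ p : ℝ × (Fin n → ℝ) in Iio m ×ˢ univ, (p.1 - m) * f p with hSm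
  have hint : Integrable (fun p : ℝ × (Fin n → ℝ) => (p.1 - m) * f p) := by
    simp only [sub_mul]
    exact hf.int1.sub (hf.int.const_mul m)
  have hSm0 : Sm ≤ 0 := by
    refine setIntegral_nonpos (measurableSet_Iio.prod MeasurableSet.univ) fun p hp => ?_
    have : p.1 < m := hp.1
    exact mul_nonpos_of_nonpos_of_nonneg (by linarith) (hf.2.1 p)
  have hSp0 : 0 < Sp := by
    have h0 : 0 ≤ Sp := by
      refine setIntegral_nonneg (measurableSet_Ioi.prod MeasurableSet.univ) fun p hp => ?_
      have : m < p.1 := hp.1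
      exact mul_nonneg (by linarith) (hf.2.1 p)
    refine lt_of_le_of_ne h0 fun hz => ?_
    have h1 := (setIntegral_eq_zero_iff_of_nonneg_ae (μ := volume)
      (s := Ioi m ×ˢ (univ : Set (Fin n → ℝ))) (f := fun p : ℝ × (Fin n → ℝ) => (p.1 - m) * f p)
      ((ae_restrict_iff' (measurableSet_Ioi.prod MeasurableSet.univ)).2 (.of_forall fun p hp => by
        have : m < p.1 := hp.1
        exact mul_nonneg (by linarith) (hf.2.1 p))) hint.integrableOn).1 hz.symm
    have h2 : ∫ p in Ioi m ×ˢ (univ : Set (Fin n → ℝ)), f p = 0 := by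
      rw [integral_eq_zero_of_ae]
      filter_upwards [h1, ae_restrict_mem (measurableSet_Ioi.prod MeasurableSet.univ)] with p h3 h4
      have : m < p.1 := h4.1
      rcases mul_eq_zero.1 h3 with h | h
      · linarith
      · exact h
    linarith
  set v : Fin n → ℝ := fun i => (Mp i - Mm i) / (Sp - Sm) with hv
  set w : ℝ × (Fin n → ℝ) := (m, fun i => (Mp i - Sp * v i) / (A / 2)) with hw
  have eqp : ∀ i, Mp i - w.2 i * (A/2) - Sp * v i = 0 := by
    intro i; simp only [hw]; field_simp; ring
  have eqm : ∀ i, Mm i - w.2 i * (A/2) - Sm * v i = 0 := by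
    intro i
    have h1 : (Sp - Sm) * v i = Mp i - Mm i := by
      simp only [hv]; field_simp [(by linarith : Sp - Sm ≠ 0)]
    linarith [eqp i]
  have momS : ∀ (S : Set ℝ) (i : Fin n), ∫ p : ℝ × (Fin n → ℝ) in S ×ˢ univ,
      (p.2 i - w.2 i - (p.1 - m) * v i) * f p = (∫ p : ℝ × (Fin n → ℝ) in S ×ˢ univ, p.2 i * f p) -
      w.2 i * (∫ p : ℝ × (Fin n → ℝ) in S ×ˢ univ, f p)
      - (∫ p : ℝ × (Fin n → ℝ) in S ×ˢ univ, (p.1 - m) * f p) * v i := by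
    intro S i
    rw [← integral_const_mul, ← integral_mul_const, ← integral_sub, ← integral_sub]
    · congr 1; ext p; ring
    · exact ((hf.int2 i).sub (hf.int.const_mul _)).restrict
    · exact (hint.mul_const _).restrict
    · exact (hf.int2 i).restrict
    · exact (hf.int.const_mul _).restrict
  refine ⟨w, fun g hg h => ?_⟩
  have i1 : ∀ k : ℝ × (Fin n → ℝ) → ℝ, ∫ p in Ioi (0:ℝ) ×ˢ univ, k (p + w) = ∫ p in Ioi m ×ˢ univ, k p := by
    intro k
    rw [← set_shift k w (Ioi m)]
    simp [hw]
  have i2 : ∀ k : ℝ × (Fin n → ℝ) → ℝ, ∫ p in Ioi (0:ℝ) ×ˢ univ, k (prefl p + w) = ∫ p in Iio m ×ˢ univ, k p := by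
    intro k
    rw [← set_shift k w (Iio m)]
    rw [← prefl_mp.setIntegral_preimage_emb prefl_emb (fun p => k (p + w))]
    congr 2
    ext p; simp [hw, prefl]
  have r1 := half_space hP (hf.shift w) hg h v (by
    intro i
    have := i1 (fun p => (p.2 i - w.2 i - (p.1 - m) * v i) * f p)
    rw [momS, hp, eqp] at this
    refine Eq.trans ?_ this; congr 1; ext p; simp [hw])
  have r2 := half_space hP (hf.shift w).refl hg.refl (by
    intro p q
    refine (h _ _).trans (le_of_eq ?_)
    simp [prefl]) (-v) (by
    intro i
    have := i2 (fun p => (p.2 i - w.2 i - (p.1 - m) * v i) * f p)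
    rw [momS, hq, eqm] at this
    refine Eq.trans ?_ this; congr 1; ext p; simp [hw, prefl])
  rw [i1 f, hp] at r1
  rw [i2 f, hq] at r2
  set Gp := ∫ q in {q : ℝ × (Fin n → ℝ) | 0 < q.1 + dotProduct v q.2}, g q with hGp
  have e2 : ∫ q in {q : ℝ × (Fin n → ℝ) | 0 < q.1 + dotProduct (-v) q.2}, g (prefl q)
      = ∫ q in {q : ℝ × (Fin n → ℝ) | 0 < q.1 + dotProduct v q.2}ᶜ, g q := by
    have h1 := prefl_mp.setIntegral_preimage_emb prefl_emb g
      {q : ℝ × (Fin n → ℝ) | q.1 + dotProduct v q.2 < 0}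
    have h2 : prefl ⁻¹' {q : ℝ × (Fin n → ℝ) | q.1 + dotProduct v q.2 < 0} =
      {q : ℝ × (Fin n → ℝ) | 0 < q.1 + dotProduct (-v) q.2} := by
      ext q; simp [prefl]
    rw [← h2, h1]
    refine setIntegral_congr_set ?_
    have hnull : volume {q : ℝ × (Fin n → ℝ) | q.1 + dotProduct v q.2 = 0} = 0 := by
      rw [← (sshear_mp v).measure_preimage_emb (sshear_emb v)]
      have : sshear v ⁻¹' {q : ℝ × (Fin n → ℝ) | q.1 + dotProduct v q.2 = 0} = {0} ×ˢ univ := by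
        ext q; simp [sshear]
      rw [this, Measure.volume_eq_prod, Measure.prod_prod]; simp
    have hae : ∀ᵐ q : ℝ × (Fin n → ℝ), ¬ (q.1 + dotProduct v q.2 = 0) := by
      rw [ae_iff]; simpa using hnull
    filter_upwards [hae] with q hq
    simp only [eq_iff_iff]
    change q.1 + dotProduct v q.2 < 0 ↔ ¬ (0 < q.1 + dotProduct v q.2)
    rw [not_lt]
    exact ⟨le_of_lt, fun h => lt_of_le_of_ne h hq⟩
  rw [e2] at r2
  have hS : MeasurableSet {q : ℝ × (Fin n → ℝ) | 0 < q.1 + dotProduct v q.2} :=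
    measurableSet_lt measurable_const (measurable_fst.add ((measurable_dot v).comp measurable_snd))
  have e3 := integral_add_compl hS hg.int
  rw [← e3, pow_succ]
  nlinarith [r1, r2]

lemma santPr (hP : SantP n) {f g : ℝ × (Fin n → ℝ) → ℝ} (hf : GoodPr n f) (hg : GoodPr n g)
    (h : ∀ p q, f p * g q ≤ exp (-(p.1 * q.1 + dotProduct p.2 q.2)))
    (b1 : ∫ p : ℝ × (Fin n → ℝ), p.1 * f p = 0)
    (b2 : ∀ i, ∫ p : ℝ × (Fin n → ℝ), p.2 i * f p = 0) :
    (∫ p, f p) * (∫ p, g p) ≤ (2 * π) ^ (n + 1) := by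
  obtain ⟨w, hw⟩ := sant_shift hP hg
  set k : ℝ × (Fin n → ℝ) → ℝ := fun p => exp (w.1 * p.1 + dotProduct w.2 p.2) * f p with hk
  have kg : GoodPr n k := by
    refine ⟨Measurable.mul (Real.measurable_exp.comp ((measurable_fst.const_mul _).add
      ((measurable_dot _).comp measurable_snd))) hf.1, fun p => mul_nonneg (exp_pos _).le (hf.2.1 p), fun a z => ?_⟩
    refine (hf.2.2 (a + w.1) (z + w.2)).congr (.of_forall fun p => ?_)
    simp only [hk, ← mul_assoc, ← Real.exp_add, add_dotProduct]
    congr 2; ring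
  have h1 := hw k kg (by
    intro p q
    have := h q (p + w)
    calc g (p + w) * k q = exp (w.1 * q.1 + dotProduct w.2 q.2) * (f q * g (p + w)) := by
          simp only [hk]; ring
      _ ≤ exp (w.1 * q.1 + dotProduct w.2 q.2) *
          exp (-(q.1 * (p + w).1 + dotProduct q.2 (p + w).2)) := by gcongr
      _ = _ := by
          rw [← Real.exp_add]; congr 1
          simp only [Prod.fst_add, Prod.snd_add, dotProduct_add]
          rw [dotProduct_comm q.2 p.2, dotProduct_comm q.2 w.2]
          ring)
  have h2 : ∫ p, f p ≤ ∫ p, k p := by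
    have e : ∫ p : ℝ × (Fin n → ℝ), (f p + w.1 * (p.1 * f p) + ∑ i, w.2 i * (p.2 i * f p)) = ∫ p, f p := by
      rw [integral_add, integral_add, integral_finset_sum]
      · simp [integral_const_mul, b1, b2]
      · exact fun i _ => (hf.int2 i).const_mul _
      · exact hf.int
      · exact hf.int1.const_mul _
      · exact hf.int.add (hf.int1.const_mul _)
      · exact integrable_finset_sum _ fun i _ => (hf.int2 i).const_mul _
    rw [← e]
    refine integral_mono ((hf.int.add (hf.int1.const_mul _)).add
      (integrable_finset_sum _ fun i _ => (hf.int2 i).const_mul _)) kg.int fun p => ?_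
    have : f p + w.1 * (p.1 * f p) + ∑ i, w.2 i * (p.2 i * f p)
        = (w.1 * p.1 + dotProduct w.2 p.2 + 1) * f p := by
      simp only [dotProduct, add_mul, Finset.sum_mul, mul_assoc]; ring
    simp only
    rw [this]
    exact mul_le_mul_of_nonneg_right (Real.add_one_le_exp _) (hf.2.1 p)
  have h3 : 0 ≤ ∫ p, g p := integral_nonneg hg.2.1
  calc _ ≤ (∫ p, k p) * ∫ p, g p := by gcongr
    _ ≤ _ := by rw [mul_comm]; exact h1

lemma santP_zero : SantP 0 := by
  intro f g _ _ h _
  have : (volume : Measure (Fin 0 → ℝ)) = Measure.dirac ![] := by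
    rw [volume_pi, Measure.pi_of_empty _ ![]]
  simp only [this, integral_dirac]
  simpa using h ![] ![]

lemma santP_succ (hP : SantP n) : SantP (n + 1) := by
  intro f g hf hg h hb
  set e := MeasurableEquiv.piFinSuccAbove (fun _ : Fin (n+1) => ℝ) 0 with he
  have mp := volume_preserving_piFinSuccAbove (fun _ : Fin (n+1) => ℝ) 0
  have mps := mp.symm
  have edot : ∀ p q : ℝ × (Fin n → ℝ), dotProduct (e.symm p) (e.symm q) =
      p.1 * q.1 + dotProduct p.2 q.2 := by
    intro p q
    simp [he, dotProduct, Fin.sum_univ_succ, MeasurableEquiv.piFinSuccAbove]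
  have good : ∀ f, GoodFn (n+1) f → GoodPr n (fun p => f (e.symm p)) := by
    intro f hf
    refine ⟨hf.1.comp e.symm.measurable, fun _ => hf.2.1 _, fun a z => ?_⟩
    have := (mps.integrable_comp_emb e.symm.measurableEmbedding).2 (hf.2.2 (e.symm (a, z)))
    refine this.congr (.of_forall fun p => ?_)
    simp only [Function.comp]
    rw [edot]
  have ie : ∀ k : (Fin (n+1) → ℝ) → ℝ, ∫ p, k (e.symm p) = ∫ x, k x := fun k =>
    mps.integral_comp e.symm.measurableEmbedding k
  have key := santPr hP (good f hf) (good g hg) (fun p q => by rw [← edot]; exact h _ _)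
    (by
      rw [← hb 0, ← ie]
      congr 1) (fun i => by
      rw [← hb i.succ, ← ie]
      congr 1)
  rwa [ie, ie] at key

lemma santP_all : ∀ n, SantP n
  | 0 => santP_zero
  | n + 1 => santP_succ (santP_all n)

end P3

section P4
variable {n : ℕ}

lemma scale_Ioi {p : ℝ} (hp : 0 < p) {G : ℝ → ENNReal} (hG : Measurable G) :
    ∫⁻ r in Ioi (0:ℝ), G (r * p) = ENNReal.ofReal p⁻¹ * ∫⁻ r in Ioi (0:ℝ), G r := by
  rw [← lintegral_indicator measurableSet_Ioi, ← lintegral_indicator measurableSet_Ioi]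
  have h := lintegral_map (μ := volume) (f := (Ioi (0:ℝ)).indicator G) (g := fun r : ℝ => r * p)
    (hG.indicator measurableSet_Ioi) (by fun_prop)
  rw [Real.map_volume_mul_right hp.ne', lintegral_smul_measure] at h
  rw [abs_of_pos (inv_pos.2 hp), smul_eq_mul] at h
  rw [h]
  refine lintegral_congr fun r => ?_
  by_cases hr : 0 < r
  · have : 0 < r * p := mul_pos hr hp
    simp [indicator, hr, this]
  · have : ¬ 0 < r * p := by
      rw [mul_pos_iff_of_pos_right hp]; exact hr
    simp [indicator, hr, this]

lemma polar_lintegral (hn : 1 ≤ n) {G : EuclideanSpace ℝ (Fin n) → ENNReal} (hG : Measurable G) :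
    ∫⁻ x, G x = ∫⁻ u, (∫⁻ r in Ioi (0:ℝ), ENNReal.ofReal (r ^ (n-1)) *
      G (r • (u : EuclideanSpace ℝ (Fin n)))) ∂(sphMeasure n) := by
  have : Nonempty (Fin n) := ⟨⟨0, hn⟩⟩
  have h1 := (volume : Measure (EuclideanSpace ℝ (Fin n))).measurePreserving_homeomorphUnitSphereProd
  have h2 := (h1.symm (homeomorphUnitSphereProd (EuclideanSpace ℝ (Fin n))).toMeasurableEquiv).lintegral_comp_emb
    ((homeomorphUnitSphereProd (EuclideanSpace ℝ (Fin n))).toMeasurableEquiv.symm.measurableEmbedding)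
    (fun x : ({(0 : EuclideanSpace ℝ (Fin n))}ᶜ : Set _) => G x)
  have h3 : ∫⁻ x, G x = ∫⁻ x : ({(0 : EuclideanSpace ℝ (Fin n))}ᶜ : Set _), G (x : EuclideanSpace ℝ (Fin n)) ∂((volume : Measure (EuclideanSpace ℝ (Fin n))).comap (↑)) := by
    rw [lintegral_subtype_comap (measurableSet_singleton _).compl]
    rw [restrict_compl_singleton]
  rw [h3, ← h2, lintegral_prod]
  · refine lintegral_congr fun u => ?_
    rw [Measure.volumeIoiPow, lintegral_withDensity_eq_lintegral_mul]
    · simp only [finrank_euclideanSpace_fin]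
      rw [← lintegral_subtype_comap measurableSet_Ioi]
      rfl
    · fun_prop
    · exact hG.comp (by
        change Measurable (fun r : Ioi (0:ℝ) => (r : ℝ) • (u : EuclideanSpace ℝ (Fin n)))
        fun_prop)
  · refine Measurable.aemeasurable ?_
    exact (hG.comp measurable_subtype_coe).comp (MeasurableEquiv.measurable _)

lemma polar_hom (hn : 1 ≤ n) (k : ℕ) {q : EuclideanSpace ℝ (Fin n) → ENNReal} (hqm : Measurable q)
    (hq : ∀ r : ℝ, 0 < r → ∀ x, q (r • x) = ENNReal.ofReal (r ^ k) * q x)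
    {p : EuclideanSpace ℝ (Fin n) → ℝ} (hpm : Measurable p)
    (hp : ∀ r : ℝ, 0 < r → ∀ x, p (r • x) = r * p x) (hp0 : ∀ x, x ≠ 0 → 0 < p x)
    {F : ℝ → ENNReal} (hF : Measurable F) :
    ∫⁻ x, q x * F (p x) = (∫⁻ u, q u * ENNReal.ofReal ((p u)⁻¹ ^ (n + k)) ∂(sphMeasure n)) *
      ∫⁻ r in Ioi (0:ℝ), ENNReal.ofReal (r ^ (n - 1 + k)) * F r := by
  rw [polar_lintegral hn (G := fun x => q x * F (p x)) (hqm.mul (hF.comp hpm)), ← lintegral_mul_const]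
  · refine lintegral_congr fun u => ?_
    have hu : (u : EuclideanSpace ℝ (Fin n)) ≠ 0 := by
      intro h; have := u.2; rw [h] at this; simp at this
    have hpu := hp0 u hu
    set G : ℝ → ENNReal := fun r => ENNReal.ofReal (r ^ (n - 1 + k)) * F r with hGdef
    have hG : Measurable G := by fun_prop
    have e1 : ∫⁻ r in Ioi (0:ℝ), ENNReal.ofReal (r ^ (n-1)) * (q (r • (u : EuclideanSpace ℝ (Fin n))) *
        F (p (r • (u : EuclideanSpace ℝ (Fin n))))) =
        ∫⁻ r in Ioi (0:ℝ), (q u * ENNReal.ofReal ((p u)⁻¹ ^ (n - 1 + k))) * G (r * p u) := by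
      refine setLIntegral_congr_fun measurableSet_Ioi fun r hr => ?_
      have hr : 0 < r := hr
      simp only [hGdef]
      rw [hq r hr, hp r hr]
      have : ENNReal.ofReal (r ^ (n-1)) * ENNReal.ofReal (r ^ k) =
        ENNReal.ofReal ((p u)⁻¹ ^ (n - 1 + k)) * ENNReal.ofReal ((r * p u) ^ (n - 1 + k)) := by
        rw [← ENNReal.ofReal_mul (by positivity), ← ENNReal.ofReal_mul (by positivity)]
        congr 1
        rw [← mul_pow, ← pow_add]; congr 1; field_simp
      calc _ = (ENNReal.ofReal (r ^ (n-1)) * ENNReal.ofReal (r ^ k)) * (q u * F (r * p u)) := by ring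
        _ = _ := by rw [this]; ring
    rw [e1, lintegral_const_mul _ (show Measurable fun r => G (r * p u) from hG.comp (by fun_prop)), scale_Ioi hpu hG]
    have e2 : ENNReal.ofReal ((p u)⁻¹ ^ (n + k)) = ENNReal.ofReal ((p u)⁻¹ ^ (n - 1 + k)) * ENNReal.ofReal (p u)⁻¹ := by
      rw [← ENNReal.ofReal_mul (by positivity), ← pow_succ]
      congr 2; omega
    rw [e2]; ring
  · fun_prop
end P4

section P5
variable {n : ℕ}

lemma supp_bdd {K : Set (EuclideanSpace ℝ (Fin n))} (hK : IsCompact K) (u : EuclideanSpace ℝ (Fin n)) :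
    BddAbove ((fun x => ⟪x, u⟫) '' K) :=
  (hK.image (by fun_prop)).bddAbove

lemma le_supp {K : Set (EuclideanSpace ℝ (Fin n))} (hK : IsCompact K) {x : EuclideanSpace ℝ (Fin n)}
    (hx : x ∈ K) (u : EuclideanSpace ℝ (Fin n)) : ⟪x, u⟫ ≤ supp K u :=
  le_csSup (supp_bdd hK u) ⟨x, hx, rfl⟩

lemma exists_supp {K : Set (EuclideanSpace ℝ (Fin n))} (hK : IsCompact K) (hne : K.Nonempty)
    (u : EuclideanSpace ℝ (Fin n)) : ∃ x ∈ K, supp K u = ⟪x, u⟫ := by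
  obtain ⟨x, hx, h⟩ := (hK.image (f := fun x => ⟪x, u⟫) (by fun_prop)).sSup_mem (hne.image _)
  exact ⟨x, hx, h.symm⟩

lemma supp_smul {K : Set (EuclideanSpace ℝ (Fin n))} (hK : IsCompact K) (hne : K.Nonempty)
    {r : ℝ} (hr : 0 ≤ r) (u : EuclideanSpace ℝ (Fin n)) : supp K (r • u) = r * supp K u := by
  obtain ⟨x, hx, h⟩ := exists_supp hK hne u
  obtain ⟨y, hy, h'⟩ := exists_supp hK hne (r • u)
  refine le_antisymm ?_ ?_
  · rw [h', inner_smul_right]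
    exact mul_le_mul_of_nonneg_left (le_supp hK hy u) hr
  · rw [h, ← inner_smul_right]; exact le_supp hK hx _

lemma supp_lip1 {K : Set (EuclideanSpace ℝ (Fin n))} (hK : IsCompact K) (hne : K.Nonempty)
    {x : EuclideanSpace ℝ (Fin n)} {R : ℝ} (hR : K ⊆ closedBall x R)
    (u v : EuclideanSpace ℝ (Fin n)) :
    (supp K u - ⟪x, u⟫) - (supp K v - ⟪x, v⟫) ≤ R * ‖u - v‖ := by
  obtain ⟨y, hy, h⟩ := exists_supp hK hne u
  have h1 := le_supp hK hy v
  have h2 : ⟪y - x, u - v⟫ ≤ ‖y - x‖ * ‖u - v‖ := real_inner_le_norm _ _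
  have h3 : ‖y - x‖ ≤ R := by simpa [dist_eq_norm] using hR hy
  have h4 : ‖y - x‖ * ‖u - v‖ ≤ R * ‖u - v‖ := by gcongr
  rw [inner_sub_left, inner_sub_right, inner_sub_right] at h2
  linarith

lemma supp_lip {K : Set (EuclideanSpace ℝ (Fin n))} (hK : IsCompact K) (hne : K.Nonempty)
    {x : EuclideanSpace ℝ (Fin n)} {R : ℝ} (hR : K ⊆ closedBall x R)
    (u v : EuclideanSpace ℝ (Fin n)) :
    |(supp K u - ⟪x, u⟫) - (supp K v - ⟪x, v⟫)| ≤ R * ‖u - v‖ := by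
  rw [abs_le]
  have := supp_lip1 hK hne hR u v
  have h2 := supp_lip1 hK hne hR v u
  rw [norm_sub_rev] at h2
  constructor <;> linarith

lemma supp_cont {K : Set (EuclideanSpace ℝ (Fin n))} (hK : IsCompact K) (hne : K.Nonempty) :
    Continuous (supp K) := by
  obtain ⟨R, hR⟩ := hK.isBounded.subset_closedBall 0
  refine (LipschitzWith.of_dist_le_mul (K := R.toNNReal) fun u v => ?_).continuous
  rw [Real.dist_eq, dist_eq_norm]
  have := supp_lip hK hne hR u v
  simp only [inner_zero_left, sub_zero] at this
  refine this.trans ?_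
  gcongr
  exact Real.le_coe_toNNReal R

lemma supp_pos {K : Set (EuclideanSpace ℝ (Fin n))} (hK : IsCompact K)
    {x : EuclideanSpace ℝ (Fin n)} (hx : x ∈ interior K) :
    ∃ ρ > 0, ∀ u : EuclideanSpace ℝ (Fin n), ρ * ‖u‖ ≤ supp K u - ⟪x, u⟫ := by
  obtain ⟨ρ, hρ, h⟩ := Metric.mem_nhds_iff.1 (mem_interior_iff_mem_nhds.1 hx)
  refine ⟨ρ / 2, by positivity, fun u => ?_⟩
  rcases eq_or_ne u 0 with rfl | hu
  · have := le_supp hK (interior_subset hx) 0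
    simpa using this
  have hu' : 0 < ‖u‖ := norm_pos_iff.2 hu
  have hm : x + (ρ / 2 / ‖u‖) • u ∈ K := by
    apply h
    rw [mem_ball, dist_eq_norm, add_sub_cancel_left, norm_smul, norm_of_nonneg (by positivity)]
    field_simp; linarith
  have := le_supp hK hm u
  rw [inner_add_left, inner_smul_left, real_inner_self_eq_norm_sq] at this
  have e : (ρ / 2 / ‖u‖) * ‖u‖ ^ 2 = ρ / 2 * ‖u‖ := by field_simp
  simp only [conj_trivial] at this
  linarith

lemma goodFn_of {f : EuclideanSpace ℝ (Fin n) → ℝ} (hm : Measurable f) (h0 : ∀ x, 0 ≤ f x)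
    {a : ℝ} (ha : 0 < a) (hb : ∀ x, f x ≤ exp (-a * ‖x‖ ^ 2)) :
    GoodFn n (fun x => f (WithLp.toLp 2 x)) := by
  refine ⟨hm.comp (MeasurableEquiv.toLp 2 _).measurable, fun _ => h0 _, fun z => ?_⟩
  have h1 := (GaussianFourier.integrable_cexp_neg_mul_sq_norm_add (b := (a : ℂ)) (by simpa using ha) 1
    (WithLp.toLp 2 z : EuclideanSpace ℝ (Fin n))).norm
  have h2 : Integrable (fun x : EuclideanSpace ℝ (Fin n) => exp (⟪WithLp.toLp 2 z, x⟫) * f x) := by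
    refine h1.mono' ((by fun_prop : Measurable fun x : EuclideanSpace ℝ (Fin n) =>
      exp (⟪(WithLp.toLp 2 z : EuclideanSpace ℝ (Fin n)), x⟫)).mul hm).aestronglyMeasurable (.of_forall fun x => ?_)
    rw [norm_of_nonneg (mul_nonneg (exp_pos _).le (h0 x)), Complex.norm_exp]
    have : (-(a:ℂ) * (‖x‖:ℂ) ^ 2 + 1 * ((⟪(WithLp.toLp 2 z : EuclideanSpace ℝ (Fin n)), x⟫ : ℝ) : ℂ)).re
      = ⟪(WithLp.toLp 2 z : EuclideanSpace ℝ (Fin n)), x⟫ + -a * ‖x‖ ^ 2 := by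
      rw [one_mul]; norm_cast; simp; ring
    rw [this, Real.exp_add]
    exact mul_le_mul_of_nonneg_left (hb x) (exp_pos _).le
  have h3 := ((PiLp.volume_preserving_toLp (Fin n)).integrable_comp_emb
    (MeasurableEquiv.toLp 2 _).measurableEmbedding).2 h2
  refine h3.congr (.of_forall fun x => ?_)
  simp [Function.comp, EuclideanSpace.inner_toLp_toLp, dotProduct_comm]

lemma santE {f g : EuclideanSpace ℝ (Fin n) → ℝ} (hf : Measurable f) (hg : Measurable g)
    (hf0 : ∀ x, 0 ≤ f x) (hg0 : ∀ x, 0 ≤ g x) {a b : ℝ} (ha : 0 < a) (hb : 0 < b)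
    (hfa : ∀ x, f x ≤ exp (-a * ‖x‖ ^ 2)) (hgb : ∀ x, g x ≤ exp (-b * ‖x‖ ^ 2))
    (h : ∀ x y, f x * g y ≤ exp (-⟪x, y⟫)) (hbar : ∀ v, ∫ x, ⟪v, x⟫ * f x = 0) :
    (∫ x, f x) * (∫ x, g x) ≤ (2 * π) ^ n := by
  have ie : ∀ k : EuclideanSpace ℝ (Fin n) → ℝ, ∫ x, k (WithLp.toLp 2 x) = ∫ x, k x := fun k =>
    (PiLp.volume_preserving_toLp (Fin n)).integral_comp
      (MeasurableEquiv.toLp 2 _).measurableEmbedding k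
  have := santP_all n _ _ (goodFn_of hf hf0 ha hfa) (goodFn_of hg hg0 hb hgb) (by
    intro x y
    refine (h _ _).trans (le_of_eq ?_)
    simp [EuclideanSpace.inner_toLp_toLp, dotProduct_comm]) (by
    intro i
    rw [← hbar (EuclideanSpace.single i 1), ← ie]
    congr 1; ext x; simp [EuclideanSpace.inner_single_left])
  rwa [ie, ie] at this
end P5

section P6
variable {n : ℕ}

def cutF (r : ℝ) : ENNReal := (Iic (1:ℝ)).indicator 1 r
def gauF (r : ℝ) : ENNReal := ENNReal.ofReal (exp (-(1/2) * r ^ 2))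

lemma cutF_meas : Measurable cutF := measurable_one.indicator measurableSet_Iic
lemma gauF_meas : Measurable gauF := by unfold gauF; fun_prop

lemma cutF_val (m : ℕ) : ∫⁻ r in Ioi (0:ℝ), ENNReal.ofReal (r ^ m) * cutF r = ENNReal.ofReal (1 / (m + 1)) := by
  have h1 : ∫⁻ r in Ioi (0:ℝ), ENNReal.ofReal (r ^ m) * cutF r = ∫⁻ r in Ioc (0:ℝ) 1, ENNReal.ofReal (r ^ m) := by
    rw [← lintegral_indicator measurableSet_Ioi, ← lintegral_indicator measurableSet_Ioc]
    refine lintegral_congr fun r => ?_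
    by_cases h0 : 0 < r <;> by_cases h1 : r ≤ 1 <;> simp [indicator, cutF, h0, h1]
  rw [h1, ← ofReal_integral_eq_lintegral_ofReal]
  · rw [← intervalIntegral.integral_of_le zero_le_one]; simp
  · exact (intervalIntegral.intervalIntegrable_pow (μ := volume) (a := 0) (b := 1) m).1
  · filter_upwards [ae_restrict_mem measurableSet_Ioc] with r hr
    have := hr.1
    positivity

/-- Santalo inequality, centered version -/
lemma bs_centered (hn : 1 ≤ n) {K : Set (EuclideanSpace ℝ (Fin n))} (hK : IsCompact K)
    (hc : Convex ℝ K) (h0 : (0 : EuclideanSpace ℝ (Fin n)) ∈ interior K)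
    (hV : volume K = volume (closedBall (0 : EuclideanSpace ℝ (Fin n)) 1))
    (hbar : ∀ v : EuclideanSpace ℝ (Fin n), ∫ x in K, ⟪v, x⟫ = 0) :
    ∫⁻ u, ENNReal.ofReal ((supp K (u : EuclideanSpace ℝ (Fin n)))⁻¹ ^ n) ∂(sphMeasure n)
      ≤ sphMeasure n univ := by
  have : Nonempty (Fin n) := ⟨⟨0, hn⟩⟩
  have hK0 := mem_interior_iff_mem_nhds.1 h0
  have hne : K.Nonempty := ⟨0, interior_subset h0⟩
  have habs : Absorbent ℝ K := absorbent_nhds_zero hK0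
  obtain ⟨R, hR0, hR⟩ := hK.isBounded.subset_closedBall_lt 0 0
  obtain ⟨ρ, hρ, hs⟩ := supp_pos hK h0
  simp only [inner_zero_left, sub_zero] at hs
  have pc : Continuous (gauge K) := continuous_gauge hc hK0
  have sc : Continuous (supp K) := supp_cont hK hne
  have pgauge : ∀ x, ‖x‖ / R ≤ gauge K x := fun x => le_gauge_of_subset_closedBall habs hR0.le hR
  have ppos : ∀ x, x ≠ 0 → 0 < gauge K x := fun x hx =>
    lt_of_lt_of_le (div_pos (norm_pos_iff.2 hx) hR0) (pgauge x)
  have phom : ∀ r : ℝ, 0 < r → ∀ x, gauge K (r • x) = r * gauge K x := fun r hr x => by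
    rw [gauge_smul_of_nonneg hr.le, smul_eq_mul]
  have spos : ∀ x, x ≠ 0 → 0 < supp K x := fun x hx =>
    lt_of_lt_of_le (mul_pos hρ (norm_pos_iff.2 hx)) (hs x)
  have shom : ∀ r : ℝ, 0 < r → ∀ x, supp K (r • x) = r * supp K x := fun r hr x =>
    supp_smul hK hne hr.le x
  have nhom : ∀ r : ℝ, 0 < r → ∀ x : EuclideanSpace ℝ (Fin n), ‖r • x‖ = r * ‖x‖ := fun r hr x => by
    rw [norm_smul, norm_of_nonneg hr.le]
  have npos : ∀ x : EuclideanSpace ℝ (Fin n), x ≠ 0 → 0 < ‖x‖ := fun x hx => norm_pos_iff.2 hx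
  have P0 : ∀ (p : EuclideanSpace ℝ (Fin n) → ℝ) (_ : Continuous p)
    (_ : ∀ r : ℝ, 0 < r → ∀ x, p (r • x) = r * p x) (_ : ∀ x, x ≠ 0 → 0 < p x)
    (F : ℝ → ENNReal) (_ : Measurable F), ∫⁻ x, F (p x) =
      (∫⁻ u, ENNReal.ofReal ((p (u : EuclideanSpace ℝ (Fin n)))⁻¹ ^ n) ∂(sphMeasure n)) *
      ∫⁻ r in Ioi (0:ℝ), ENNReal.ofReal (r ^ (n - 1)) * F r := by
    intro p h1 h2 h3 F hF
    simpa using polar_hom hn 0 (q := fun _ => 1) measurable_const (by simp) h1.measurable h2 h3 hF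
  have Inorm : ∫⁻ u : sphere (0 : EuclideanSpace ℝ (Fin n)) 1,
      ENNReal.ofReal (‖(u : EuclideanSpace ℝ (Fin n))‖⁻¹ ^ n) ∂(sphMeasure n) = sphMeasure n univ := by
    simp
  have volp : ∀ x, x ∈ K ↔ gauge K x ≤ 1 := fun x => by
    rw [gauge_le_one_iff_mem_closure hc hK0, hK.isClosed.closure_eq]
  have v1 : ∫⁻ x, cutF (gauge K x) = volume K := by
    rw [← lintegral_indicator_one hK.measurableSet]
    refine lintegral_congr fun x => ?_
    simp [cutF, indicator, volp]
  have v2 : ∫⁻ x : EuclideanSpace ℝ (Fin n), cutF ‖x‖ = volume (closedBall (0 : EuclideanSpace ℝ (Fin n)) 1) := by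
    rw [← lintegral_indicator_one measurableSet_closedBall]
    refine lintegral_congr fun x => ?_
    simp [cutF, indicator]
  have hI : ∫⁻ u, ENNReal.ofReal ((gauge K (u : EuclideanSpace ℝ (Fin n)))⁻¹ ^ n) ∂(sphMeasure n)
      = sphMeasure n univ := by
    have a1 := P0 _ pc phom ppos cutF cutF_meas
    have a2 := P0 _ continuous_norm nhom npos cutF cutF_meas
    rw [v1, hV, ← v2, a2, Inorm, cutF_val] at a1
    refine ((ENNReal.mul_left_inj ?_ ENNReal.ofReal_ne_top).1 a1).symm
    rw [Ne, ENNReal.ofReal_eq_zero, not_le]; positivity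
  set f : EuclideanSpace ℝ (Fin n) → ℝ := fun x => exp (-(1/2) * (gauge K x) ^ 2) with hf
  set g : EuclideanSpace ℝ (Fin n) → ℝ := fun x => exp (-(1/2) * (supp K x) ^ 2) with hg
  have fm : Measurable f := by fun_prop
  have gm : Measurable g := by fun_prop
  have fa : ∀ x, f x ≤ exp (-(1 / (2 * R ^ 2)) * ‖x‖ ^ 2) := by
    intro x
    apply exp_le_exp.2
    have : (‖x‖ / R) ^ 2 ≤ gauge K x ^ 2 := by
      gcongr; exact pgauge x
    rw [div_pow] at this
    have e : (1 / (2 * R ^ 2)) * ‖x‖ ^ 2 = 1/2 * (‖x‖ ^ 2 / R ^ 2) := by field_simp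
    nlinarith
  have gb : ∀ x, g x ≤ exp (-(ρ ^ 2 / 2) * ‖x‖ ^ 2) := by
    intro x
    apply exp_le_exp.2
    have : (ρ * ‖x‖) ^ 2 ≤ supp K x ^ 2 := by
      gcongr; exact hs x
    nlinarith
  have fg : ∀ x y, f x * g y ≤ exp (-⟪x, y⟫) := by
    intro x y
    simp only [hf, hg]
    rw [← Real.exp_add]
    apply exp_le_exp.2
    have hxy : ⟪x, y⟫ ≤ gauge K x * supp K y := by
      rcases eq_or_ne x 0 with rfl | hx
      · simp
      have hp := ppos x hx
      have : (gauge K x)⁻¹ • x ∈ K := by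
        rw [volp, phom _ (inv_pos.2 hp), inv_mul_cancel₀ hp.ne']
      have := le_supp hK this y
      rw [inner_smul_left] at this
      simp only [conj_trivial] at this
      rwa [inv_mul_le_iff₀ hp] at this
    nlinarith [sq_nonneg (gauge K x - supp K y)]
  have Iint : ∀ (p : EuclideanSpace ℝ (Fin n) → ℝ) (_ : Measurable p),
      ∫ x, exp (-(1/2) * (p x) ^ 2) = (∫⁻ x, gauF (p x)).toReal := by
    intro p hp
    rw [integral_eq_lintegral_of_nonneg_ae (.of_forall fun x => (exp_pos _).le)
      (by fun_prop : Measurable fun x => exp (-(1/2) * (p x) ^ 2)).aestronglyMeasurable]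
    rfl
  set J := ∫⁻ r in Ioi (0:ℝ), ENNReal.ofReal (r ^ (n - 1)) * gauF r with hJ
  have gN := P0 _ continuous_norm nhom npos gauF gauF_meas
  have gP := P0 _ pc phom ppos gauF gauF_meas
  have gS := P0 _ sc shom spos gauF gauF_meas
  rw [Inorm] at gN
  rw [hI, ← gN] at gP
  set s : ℝ := ∫ x : EuclideanSpace ℝ (Fin n), exp (-(1/2) * ‖x‖ ^ 2) with hsdef
  have hs0 := GaussianFourier.integral_rexp_neg_mul_sq_norm (V := EuclideanSpace ℝ (Fin n))
    (b := 1/2) (by norm_num)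
  rw [← hsdef, finrank_euclideanSpace_fin] at hs0
  have hspos : 0 < s := by rw [hs0]; positivity
  have hss : s * s = (2 * π) ^ n := by
    rw [hs0, ← Real.rpow_add (by positivity), ← Real.rpow_natCast]
    congr 1 <;> ring
  have hf1 : ∫ x, f x = s := by
    rw [hsdef, hf, Iint _ pc.measurable, Iint _ continuous_norm.measurable, gP]
  have bar : ∀ v, ∫ x, ⟪v, x⟫ * f x = 0 := by
    intro v
    by_cases hint : Integrable (fun x => ⟪v, x⟫ * f x)
    swap
    · exact integral_undef hint
    have Q : ∀ (w : EuclideanSpace ℝ (Fin n)) (F : ℝ → ENNReal) (_ : Measurable F),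
        ∫⁻ x, ENNReal.ofReal ⟪w, x⟫ * F (gauge K x) = 
        (∫⁻ u, ENNReal.ofReal ⟪w, (u : EuclideanSpace ℝ (Fin n))⟫ *
          ENNReal.ofReal ((gauge K (u : EuclideanSpace ℝ (Fin n)))⁻¹ ^ (n + 1)) ∂(sphMeasure n)) *
          ∫⁻ r in Ioi (0:ℝ), ENNReal.ofReal (r ^ (n - 1 + 1)) * F r := by
      intro w F hF
      refine polar_hom hn 1 (q := fun x => ENNReal.ofReal ⟪w, x⟫) (by fun_prop) ?_ pc.measurable phom ppos hF
      intro r hr x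
      rw [inner_smul_right, ENNReal.ofReal_mul hr.le, pow_one]
    have kv : ∀ w : EuclideanSpace ℝ (Fin n), ∫⁻ x, ENNReal.ofReal ⟪w, x⟫ * cutF (gauge K x) =
        ∫⁻ x in K, ENNReal.ofReal ⟪w, x⟫ := by
      intro w
      rw [← lintegral_indicator hK.measurableSet]
      refine lintegral_congr fun x => ?_
      by_cases hx : gauge K x ≤ 1 <;> simp [cutF, indicator, volp, hx]
    have iK : Integrable (fun x => ⟪v, x⟫) (volume.restrict K) :=
      (by fun_prop : Continuous fun x : EuclideanSpace ℝ (Fin n) => ⟪v, x⟫).continuousOn.integrableOn_compact hK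
    have iKn : Integrable (fun x => ⟪-v, x⟫) (volume.restrict K) :=
      (by fun_prop : Continuous fun x : EuclideanSpace ℝ (Fin n) => ⟪-v, x⟫).continuousOn.integrableOn_compact hK
    have eqK : ∫⁻ x in K, ENNReal.ofReal ⟪v, x⟫ = ∫⁻ x in K, ENNReal.ofReal ⟪-v, x⟫ := by
      have e := integral_eq_lintegral_pos_part_sub_lintegral_neg_part iK
      rw [hbar v] at e
      simp only [← inner_neg_left] at e
      exact (ENNReal.toReal_eq_toReal_iff' iK.lintegral_lt_top.ne iKn.lintegral_lt_top.ne).1 (by linarith)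
    rw [← kv, ← kv, Q _ _ cutF_meas, Q _ _ cutF_meas, cutF_val] at eqK
    have eqA := (ENNReal.mul_left_inj (by
      rw [Ne, ENNReal.ofReal_eq_zero, not_le]; positivity) ENNReal.ofReal_ne_top).1 eqK
    have eqf : ∫⁻ x, ENNReal.ofReal ⟪v, x⟫ * gauF (gauge K x) = ∫⁻ x, ENNReal.ofReal ⟪-v, x⟫ * gauF (gauge K x) := by
      rw [Q _ _ gauF_meas, Q _ _ gauF_meas, eqA]
    rw [integral_eq_lintegral_pos_part_sub_lintegral_neg_part hint]
    simp only [← neg_mul, ← inner_neg_left]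
    simp only [hf, ENNReal.ofReal_mul' (exp_pos _).le]
    unfold gauF at eqf
    rw [eqf, sub_self]
  have main := santE fm gm (fun x => (exp_pos _).le) (fun x => (exp_pos _).le)
    (by positivity : 0 < 1 / (2 * R ^ 2)) (by positivity : 0 < ρ ^ 2 / 2) fa gb fg bar
  rw [hf1, ← hss] at main
  have hgs : ∫ x, g x ≤ s := le_of_mul_le_mul_left main hspos
  have gfin : ∫⁻ x, gauF (supp K x) ≠ ⊤ := by
    have h1 : Integrable (fun x : EuclideanSpace ℝ (Fin n) => exp (-(ρ ^ 2 / 2) * ‖x‖ ^ 2)) := by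
      by_contra hcon
      have := integral_undef hcon
      rw [GaussianFourier.integral_rexp_neg_mul_sq_norm (by positivity)] at this
      have h2 : 0 < (π / (ρ ^ 2 / 2)) ^ ((Module.finrank ℝ (EuclideanSpace ℝ (Fin n)) : ℝ) / 2) := by positivity
      linarith
    have h2 : Integrable g := h1.mono' gm.aestronglyMeasurable (.of_forall fun x => by
      rw [norm_of_nonneg (exp_pos _).le]; exact gb x)
    exact h2.lintegral_lt_top.ne
  have nfin : ∫⁻ x : EuclideanSpace ℝ (Fin n), gauF ‖x‖ ≠ ⊤ := by
    intro h
    rw [Iint _ continuous_norm.measurable, h] at hsdef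
    simp at hsdef; linarith
  have nn0 : ∫⁻ x : EuclideanSpace ℝ (Fin n), gauF ‖x‖ ≠ 0 := by
    intro h
    rw [Iint _ continuous_norm.measurable, h] at hsdef
    simp at hsdef; linarith
  rw [hg, Iint _ sc.measurable, hsdef, Iint _ continuous_norm.measurable,
    ENNReal.toReal_le_toReal gfin nfin, gS, gN] at hgs
  rw [gN] at nfin nn0
  have J0 : J ≠ 0 := right_ne_zero_of_mul nn0
  have s0 : sphMeasure n univ ≠ 0 := left_ne_zero_of_mul nn0
  have Jt : J ≠ ⊤ := fun h => nfin (by rw [← hJ, h]; exact ENNReal.mul_top s0)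
  exact (ENNReal.mul_le_mul_iff_left J0 Jt).1 hgs
end P6

section P7
variable {n : ℕ}

lemma image_sub_eq (K : Set (EuclideanSpace ℝ (Fin n))) (c : EuclideanSpace ℝ (Fin n)) :
    (fun x => x - c) '' K = (fun x => x + c) ⁻¹' K := by
  ext x; constructor
  · rintro ⟨y, hy, rfl⟩; simpa using hy
  · intro h; exact ⟨x + c, h, by simp⟩

lemma supp_sub {K : Set (EuclideanSpace ℝ (Fin n))} (hK : IsCompact K) (hne : K.Nonempty)
    (c u : EuclideanSpace ℝ (Fin n)) :
    supp ((fun x => x - c) '' K) u = supp K u - ⟪c, u⟫ := by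
  have hK' : IsCompact ((fun x => x - c) '' K) := hK.image (by fun_prop)
  apply le_antisymm
  · obtain ⟨y, ⟨x, hx, rfl⟩, h⟩ := exists_supp hK' (hne.image _) u
    rw [h, inner_sub_left]
    linarith [le_supp hK hx u]
  · obtain ⟨x, hx, h⟩ := exists_supp hK hne u
    rw [h, ← inner_sub_left]
    exact le_supp hK' ⟨x, hx, rfl⟩ u

lemma bs_body (hn : 1 ≤ n) {K : Set (EuclideanSpace ℝ (Fin n))} (hK : IsConvexBody K)
    (hV : volume K = volume (closedBall (0 : EuclideanSpace ℝ (Fin n)) 1)) :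
    ∃ c ∈ interior K, ∫⁻ u, ENNReal.ofReal ((supp K (u : EuclideanSpace ℝ (Fin n)) -
      ⟪c, (u : EuclideanSpace ℝ (Fin n))⟫)⁻¹ ^ n) ∂(sphMeasure n) ≤ sphMeasure n univ := by
  obtain ⟨hK, hc, hi⟩ := hK
  have hne : K.Nonempty := hi.mono interior_subset
  have Vtop : volume K ≠ ⊤ := hK.measure_lt_top.ne
  have Vpos : 0 < volume.real K := by
    rw [measureReal_def]
    refine ENNReal.toReal_pos ?_ Vtop
    rw [hV]; exact (measure_closedBall_pos volume 0 one_pos).ne'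
  set c : EuclideanSpace ℝ (Fin n) := (volume.real K)⁻¹ • ∫ x in K, x with hcdef
  have iid : IntegrableOn (fun x : EuclideanSpace ℝ (Fin n) => x) K :=
    continuous_id.continuousOn.integrableOn_compact hK
  have hcv : ∀ v : EuclideanSpace ℝ (Fin n), ∫ x in K, ⟪v, x⟫ = volume.real K * ⟪v, c⟫ := by
    intro v
    rw [integral_inner iid v, hcdef, inner_smul_right, mul_inv_cancel_left₀ Vpos.ne']
  have iv : ∀ v : EuclideanSpace ℝ (Fin n), IntegrableOn (fun x => ⟪v, x⟫) K := fun v =>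
    (by fun_prop : Continuous fun x : EuclideanSpace ℝ (Fin n) => ⟪v, x⟫).continuousOn.integrableOn_compact hK
  have hci : c ∈ interior K := by
    by_contra hcon
    obtain ⟨f, hf⟩ := geometric_hahn_banach_open_point hc.interior isOpen_interior hcon
    set v := (InnerProductSpace.toDual ℝ (EuclideanSpace ℝ (Fin n))).symm f with hv
    have hfv : ∀ x, f x = ⟪v, x⟫ := fun x => by
      rw [hv, InnerProductSpace.toDual_symm_apply]
    simp only [hfv] at hf
    have hcl : K ⊆ closure (interior K) := by
      rw [hc.closure_interior_eq_closure_of_nonempty_interior hi]; exact subset_closure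
    have hle : ∀ x ∈ K, ⟪v, x⟫ ≤ ⟪v, c⟫ := by
      intro x hx
      exact closure_minimal (s := interior K) (t := {x | ⟪v, x⟫ ≤ ⟪v, c⟫}) (fun y hy => (hf y hy).le)
        (isClosed_le (by fun_prop) continuous_const) (hcl hx)
    have h0 : ∫ x in K, (⟪v, c⟫ - ⟪v, x⟫) = 0 := by
      rw [integral_sub (integrable_const_iff.2 (Or.inr ⟨by simpa using Vtop.lt_top⟩)) (iv v), hcv]
      simp
    have hz := (setIntegral_eq_zero_iff_of_nonneg_ae (μ := volume)
      ((ae_restrict_iff' hK.measurableSet).2 (.of_forall fun x hx => sub_nonneg.2 (hle x hx)))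
      (IntegrableOn.sub (integrableOn_const Vtop) (iv v))).1 h0
    have hz' : ∀ᵐ x ∂(volume.restrict K), x ∉ interior K := by
      filter_upwards [hz] with x hx hxi
      have := hf x hxi
      simp only [Pi.zero_apply] at hx
      linarith
    rw [ae_restrict_iff' hK.measurableSet, ae_iff] at hz'
    have : interior K ⊆ {a | ¬(a ∈ K → a ∉ interior K)} := fun x hx => by
      simp only [mem_setOf_eq, Classical.not_imp, not_not]
      exact ⟨interior_subset hx, hx⟩
    exact (isOpen_interior.measure_pos volume hi).ne' (measure_mono_null this hz')
  refine ⟨c, hci, ?_⟩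
  have mp := measurePreserving_add_right (volume : Measure (EuclideanSpace ℝ (Fin n))) c
  have emb := (MeasurableEquiv.addRight c).measurableEmbedding
  have hK' : IsCompact ((fun x => x - c) '' K) := hK.image (by fun_prop)
  have key := bs_centered hn hK' (by
    have := hc.translate (-c)
    simpa only [sub_eq_neg_add] using this) (by
    rw [image_sub_eq]
    have := (Homeomorph.addRight c).preimage_interior K
    change (0 : EuclideanSpace ℝ (Fin n)) ∈ interior ((Homeomorph.addRight c) ⁻¹' K)
    rw [← this]; simpa using hci) (by
    rw [← hV, image_sub_eq, mp.measure_preimage_emb emb]) (by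
    intro v
    rw [image_sub_eq]
    have := mp.setIntegral_preimage_emb emb (fun x => ⟪v, x⟫ - ⟪v, c⟫) K
    simp only [inner_add_right, add_sub_cancel_right] at this
    rw [this, integral_sub (iv v) (integrableOn_const Vtop), hcv]
    simp)
  simpa only [supp_sub hK hne] using key
end P7

section P8
variable {m : ℕ}

lemma exists_iso (w : EuclideanSpace ℝ (Fin (m+1))) (hw : ‖w‖ = 1) :
    ∃ L : EuclideanSpace ℝ (Fin (m+1)) ≃ₗᵢ[ℝ] EuclideanSpace ℝ (Fin (m+1)), ∀ x, (L x) 0 = ⟪w, x⟫ := by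
  obtain ⟨b, hb⟩ := Orthonormal.exists_orthonormalBasis_extension_of_card_eq (𝕜 := ℝ)
    (E := EuclideanSpace ℝ (Fin (m+1))) (ι := Fin (m+1)) (by simp) (v := fun _ => w) (s := {0}) (by
      constructor
      · intro i; simpa using hw
      · intro i j hij
        exact absurd (Subsingleton.elim i j) hij)
  refine ⟨b.repr, fun x => ?_⟩
  rw [b.repr_apply_apply, hb 0 rfl]

lemma sing_int : ∫⁻ t in Ioc (-1:ℝ) 1, (ENNReal.ofReal |t|) ^ (-(1/2) : ℝ) < ⊤ := by
  have i1 : IntegrableOn (fun t : ℝ => t ^ (-(1/2) : ℝ)) (Ioc (-1) 1) :=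
    (intervalIntegral.intervalIntegrable_rpow' (a := -1) (b := 1) (by norm_num : (-1:ℝ) < -(1/2))).1
  have i2 : IntegrableOn (fun t : ℝ => (-t) ^ (-(1/2) : ℝ)) (Ioc (-1) 1) := by
    have := (intervalIntegral.intervalIntegrable_rpow' (a := 1) (b := -1) (by norm_num : (-1:ℝ) < -(1/2)))
    have h2 := (IntervalIntegrable.comp_sub_left this 0)
    simp only [zero_sub, neg_neg] at h2
    exact h2.1
  have h := ENNReal.add_lt_top.2 ⟨i1.lintegral_lt_top, i2.lintegral_lt_top⟩
  refine lt_of_le_of_lt ?_ h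
  rw [← lintegral_add_left' i1.aemeasurable.ennreal_ofReal]
  refine lintegral_mono_ae ?_
  have : ∀ᵐ t ∂(volume.restrict (Ioc (-1:ℝ) 1)), t ≠ 0 :=
    ae_restrict_of_ae (by simp [ae_iff])
  filter_upwards [this] with t ht
  rw [ENNReal.ofReal_rpow_of_pos (abs_pos.2 ht)]
  rcases lt_or_gt_of_ne ht with h | h
  · rw [abs_of_neg h]; exact le_add_self
  · rw [abs_of_pos h]; exact le_self_add

lemma sing_ball : ∫⁻ x : EuclideanSpace ℝ (Fin (m+1)), cutF ‖x‖ * (ENNReal.ofReal |x 0|) ^ (-(1/2) : ℝ) < ⊤ := by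
  rw [← (PiLp.volume_preserving_toLp (Fin (m+1))).lintegral_comp_emb
      (MeasurableEquiv.toLp 2 _).measurableEmbedding]
  rw [← (volume_preserving_piFinSuccAbove (fun _ : Fin (m+1) => ℝ) 0).symm.lintegral_comp_emb
    (MeasurableEquiv.measurableEmbedding _)]
  set φ : ℝ → ENNReal := (Ioc (-2:ℝ) 1).indicator 1
  have hle : ∀ p : ℝ × (Fin m → ℝ), cutF ‖(WithLp.toLp 2 ((MeasurableEquiv.piFinSuccAbove (fun _ : Fin (m+1) => ℝ) 0).symm p) :
      EuclideanSpace ℝ (Fin (m+1)))‖ *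
    (ENNReal.ofReal |(WithLp.toLp 2 ((MeasurableEquiv.piFinSuccAbove (fun _ : Fin (m+1) => ℝ) 0).symm p) :
      EuclideanSpace ℝ (Fin (m+1))) 0|) ^ (-(1/2) : ℝ) ≤
      ((Icc (-1:ℝ) 1).indicator (fun t => (ENNReal.ofReal |t|) ^ (-(1/2) : ℝ)) p.1) *
      ((Icc (-1 : Fin m → ℝ) 1).indicator 1 p.2) := by
    intro p
    set x : EuclideanSpace ℝ (Fin (m+1)) := WithLp.toLp 2 ((MeasurableEquiv.piFinSuccAbove (fun _ : Fin (m+1) => ℝ) 0).symm p) with hx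
    have x0 : x 0 = p.1 := by simp [hx, MeasurableEquiv.piFinSuccAbove]
    have xs : ∀ i : Fin m, x i.succ = p.2 i := by intro i; simp [hx, MeasurableEquiv.piFinSuccAbove]
    by_cases hn : ‖x‖ ≤ 1
    · have hc : ∀ i, |x i| ≤ 1 := fun i => (PiLp.norm_apply_le x i).trans hn
      have h1 : p.1 ∈ Icc (-1:ℝ) 1 := by rw [← x0]; exact abs_le.1 (hc 0)
      have h2 : p.2 ∈ Icc (-1 : Fin m → ℝ) 1 := by
        constructor <;> intro i <;> have := abs_le.1 (hc i.succ) <;> rw [xs] at this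
        · exact this.1
        · exact this.2
      rw [indicator_of_mem h1, indicator_of_mem h2, x0]
      simp [cutF, indicator, hn]
    · simp [cutF, indicator, hn]
  refine lt_of_le_of_lt (lintegral_mono hle) ?_
  rw [Measure.volume_eq_prod, lintegral_prod_mul]
  · rw [lintegral_indicator measurableSet_Icc, lintegral_indicator_one measurableSet_Icc]
    refine ENNReal.mul_lt_top ?_ isCompact_Icc.measure_lt_top
    rw [restrict_Ioc_eq_restrict_Icc.symm]
    exact sing_int
  · exact ((by fun_prop : Measurable fun t : ℝ => (ENNReal.ofReal |t|) ^ (-(1/2) : ℝ)).indicator measurableSet_Icc).aemeasurable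
  · exact (measurable_one.indicator measurableSet_Icc).aemeasurable

lemma sing_sphere : ∃ M : ℝ, 0 < M ∧ ∀ w : EuclideanSpace ℝ (Fin (m+1)), ‖w‖ = 1 →
    ∫⁻ u, (ENNReal.ofReal |⟪w, (u : EuclideanSpace ℝ (Fin (m+1)))⟫|) ^ (-(1/2) : ℝ) ∂(sphMeasure (m+1))
      ≤ ENNReal.ofReal M := by
  set A := ∫⁻ x : EuclideanSpace ℝ (Fin (m+1)), cutF ‖x‖ * (ENNReal.ofReal |x 0|) ^ (-(1/2) : ℝ) with hA
  have hAt : A < ⊤ := sing_ball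
  refine ⟨(m + 1) * A.toReal + 1, by positivity, fun w hw => ?_⟩
  obtain ⟨L, hL⟩ := exists_iso w hw
  have e1 : A = ∫⁻ x : EuclideanSpace ℝ (Fin (m+1)), cutF ‖x‖ * (ENNReal.ofReal |⟪w, x⟫|) ^ (-(1/2) : ℝ) := by
    rw [hA, ← L.measurePreserving.lintegral_comp_emb L.toHomeomorph.measurableEmbedding]
    refine lintegral_congr fun x => ?_
    rw [hL, L.norm_map]
  have hmeas : Measurable fun x : EuclideanSpace ℝ (Fin (m+1)) => (ENNReal.ofReal |⟪w, x⟫|) ^ (-(1/2) : ℝ) := by fun_prop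
  rw [polar_lintegral (by omega) (G := fun x => cutF ‖x‖ * (ENNReal.ofReal |⟪w, x⟫|) ^ (-(1/2) : ℝ)) ((cutF_meas.comp measurable_norm).mul hmeas)] at e1
  have e2 : ∫⁻ u, (ENNReal.ofReal (1 / (m + 1))) * (ENNReal.ofReal |⟪w, (u : EuclideanSpace ℝ (Fin (m+1)))⟫|) ^ (-(1/2) : ℝ) ∂(sphMeasure (m+1)) ≤ A := by
    rw [e1]
    refine lintegral_mono fun u => ?_
    rw [← cutF_val, ← lintegral_mul_const _ (by have := cutF_meas; fun_prop)]
    refine setLIntegral_mono' measurableSet_Ioi fun r hr => ?_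
    have hr : 0 < r := hr
    have hu : ‖(u : EuclideanSpace ℝ (Fin (m+1)))‖ = 1 := by simp
    simp only [Nat.add_sub_cancel, Function.comp, Pi.mul_apply]
    rw [norm_smul, hu, mul_one, norm_of_nonneg hr.le, mul_assoc]
    refine mul_le_mul' le_rfl ?_
    by_cases h1 : r ≤ 1
    · refine mul_le_mul' le_rfl ?_
      rw [ENNReal.rpow_neg, ENNReal.rpow_neg]
      refine ENNReal.inv_le_inv.2 (ENNReal.rpow_le_rpow (ENNReal.ofReal_le_ofReal ?_) (by norm_num))
      rw [inner_smul_right, abs_mul, abs_of_pos hr]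
      exact mul_le_of_le_one_left (abs_nonneg _) h1
    · simp [cutF, indicator, h1]
  rw [lintegral_const_mul _ (show Measurable fun u : sphere (0 : EuclideanSpace ℝ (Fin (m+1))) 1 => (ENNReal.ofReal |⟪w,(u:EuclideanSpace ℝ (Fin (m+1)))⟫|)^(-(1/2):ℝ) from hmeas.comp measurable_subtype_coe)] at e2
  have e3 : (ENNReal.ofReal (m + 1)) * (ENNReal.ofReal (1 / (m + 1))) = 1 := by
    rw [← ENNReal.ofReal_mul (by positivity)]
    rw [mul_one_div_cancel (by positivity)]; simp
  calc _ = (ENNReal.ofReal (m + 1)) * ((ENNReal.ofReal (1 / (m + 1))) * ∫⁻ u, (ENNReal.ofReal |⟪w, (u : EuclideanSpace ℝ (Fin (m+1)))⟫|) ^ (-(1/2) : ℝ) ∂(sphMeasure (m+1))) := by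
        rw [← mul_assoc, e3, one_mul]
    _ ≤ (ENNReal.ofReal (m + 1)) * A := by gcongr
    _ = ENNReal.ofReal ((m+1) * A.toReal) := by
        rw [ENNReal.ofReal_mul (by positivity), ENNReal.ofReal_toReal hAt.ne]
    _ ≤ _ := ENNReal.ofReal_le_ofReal (by linarith)

lemma cap_mem {u : EuclideanSpace ℝ (Fin (m+1))} (hu : ‖u‖ = 1) {s : ℝ} (hs1 : s ≤ 1)
    {x : EuclideanSpace ℝ (Fin (m+1))} (h1 : 1/2 < ⟪u, x⟫) (h2 : ⟪u, x⟫ < 3/4)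
    (h3 : ‖x - ⟪u, x⟫ • u‖ < s / 4) : 0 < ‖x‖ ∧ ‖x‖ < 1 ∧ ‖‖x‖⁻¹ • x - u‖ < s := by
  set a := ⟪u, x⟫ with ha
  have hau : ‖a • u‖ = a := by rw [norm_smul, hu, mul_one, norm_of_nonneg (by linarith)]
  have n1 : ‖x‖ ≤ a + ‖x - a • u‖ := by
    have := norm_add_le (a • u) (x - a • u)
    rw [hau] at this; simpa using this
  have n2 : a ≤ ‖x‖ := by
    have := real_inner_le_norm u x
    rw [hu, one_mul] at this; exact this
  have hx : 0 < ‖x‖ := by linarith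
  refine ⟨hx, by linarith, ?_⟩
  have e : ‖x‖⁻¹ • x - u = ‖x‖⁻¹ • ((x - a • u) + (a - ‖x‖) • u) := by
    rw [sub_smul, sub_add_sub_cancel, smul_sub, smul_smul, inv_mul_cancel₀ hx.ne', one_smul]
  rw [e, norm_smul, norm_inv, norm_norm, inv_mul_lt_iff₀ hx]
  have := norm_add_le (x - a • u) ((a - ‖x‖) • u)
  rw [norm_smul (a - ‖x‖), hu, mul_one, norm_eq_abs, abs_of_nonpos (by linarith)] at this
  have hspos : 0 < s := by linarith [norm_nonneg (x - a • u)]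
  nlinarith

lemma cap_bound : ∃ c : ℝ, 0 < c ∧ ∀ u : sphere (0 : EuclideanSpace ℝ (Fin (m+1))) 1, ∀ s : ℝ,
    0 < s → s ≤ 1 → c * s ^ m ≤ (sphMeasure (m+1)).real (ball u s) := by
  refine ⟨(m+1) * (1/4 * (1 / (2 * (m + 1))) ^ m), by positivity, fun u s hs hs1 => ?_⟩
  have hu : ‖(u : EuclideanSpace ℝ (Fin (m+1)))‖ = 1 := by simp
  obtain ⟨L, hL⟩ := exists_iso (u : EuclideanSpace ℝ (Fin (m+1))) hu
  set δ : ℝ := s / (4 * (m + 1)) with hδ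
  have hδ0 : 0 < δ := by positivity
  set box : Set (Fin (m+1) → ℝ) := pi univ (Fin.cons (Ioo (1/2) (3/4)) (fun _ : Fin m => Ioo (-δ) δ) : Fin (m+1) → Set ℝ) with hbox
  have hbv : volume box = ENNReal.ofReal (1/4 * (s / (2 * (m+1))) ^ m) := by
    rw [hbox, volume_pi_pi, Fin.prod_univ_succ]
    simp only [Fin.cons_zero, Fin.cons_succ, Real.volume_Ioo, Finset.prod_const, Finset.card_univ, Fintype.card_fin]
    rw [← ENNReal.ofReal_pow (by linarith), ← ENNReal.ofReal_mul (by norm_num)]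
    congr 2
    · norm_num
    · rw [hδ]; congr 1; field_simp; ring
  have hbm : MeasurableSet box := by
    refine MeasurableSet.univ_pi fun i => ?_
    refine Fin.cases ?_ (fun i => ?_) i
    · exact measurableSet_Ioo
    · exact measurableSet_Ioo
  have mp := (PiLp.volume_preserving_ofLp (Fin (m+1))).comp L.measurePreserving
  have hsub : (fun x => (L x).ofLp) ⁻¹' box ⊆ Ioo (0:ℝ) 1 • ((↑) '' ball u s) := by
    intro x hx
    have hx0 : (L x) 0 ∈ Ioo (1/2 : ℝ) (3/4) := hx 0 (mem_univ _)
    have hxs : ∀ i : Fin m, (L x) i.succ ∈ Ioo (-δ) δ := fun i => hx i.succ (mem_univ _)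
    rw [hL] at hx0
    have hLu : ∀ i : Fin m, (L u) i.succ = 0 := by
      have h1 : ‖L u‖ ^ 2 = 1 := by rw [L.norm_map, hu]; norm_num
      rw [EuclideanSpace.norm_sq_eq, Fin.sum_univ_succ, hL, real_inner_self_eq_norm_sq, hu] at h1
      simp only [one_pow, norm_one, norm_eq_abs, sq_abs, add_eq_left] at h1
      intro i
      have := (Finset.sum_eq_zero_iff_of_nonneg (fun i _ => sq_nonneg _)).1 h1 i (Finset.mem_univ i)
      simpa using this
    have h3 : ‖x - ⟪(u : EuclideanSpace ℝ (Fin (m+1))), x⟫ • (u : EuclideanSpace ℝ (Fin (m+1)))‖ < s / 4 := by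
      rw [← L.norm_map]
      refine lt_of_pow_lt_pow_left₀ 2 (by positivity) ?_
      rw [EuclideanSpace.norm_sq_eq, Fin.sum_univ_succ]
      have z0 : (L (x - ⟪(u : EuclideanSpace ℝ (Fin (m+1))), x⟫ • (u : EuclideanSpace ℝ (Fin (m+1))))) 0 = 0 := by
        rw [hL, inner_sub_right, inner_smul_right, real_inner_self_eq_norm_sq, hu]; ring
      have zs : ∀ i : Fin m, (L (x - ⟪(u : EuclideanSpace ℝ (Fin (m+1))), x⟫ • (u : EuclideanSpace ℝ (Fin (m+1))))) i.succ = (L x) i.succ := by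
        intro i
        rw [map_sub, map_smul]
        simp [hLu i]
      rw [z0]
      simp only [zs, norm_zero, norm_eq_abs, sq_abs]
      have : ∑ i : Fin m, (L x) i.succ ^ 2 ≤ ∑ i : Fin m, δ ^ 2 :=
        Finset.sum_le_sum fun i _ => by
          have := hxs i
          exact sq_le_sq' this.1.le this.2.le
      simp only [Finset.sum_const, Finset.card_univ, Fintype.card_fin, nsmul_eq_mul] at this
      have e : s / 4 = (m + 1) * δ := by rw [hδ]; field_simp
      rw [e]
      have hm : (0:ℝ) ≤ m := Nat.cast_nonneg m
      nlinarith [mul_pos hδ0 hδ0, mul_nonneg hm (mul_pos hδ0 hδ0).le, mul_nonneg (mul_nonneg hm hm) (mul_pos hδ0 hδ0).le]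
    obtain ⟨p1, p2, p3⟩ := cap_mem hu hs1 hx0.1 hx0.2 h3
    refine ⟨‖x‖, ⟨p1, p2⟩, ‖x‖⁻¹ • x, ⟨⟨‖x‖⁻¹ • x, ?_⟩, ?_, rfl⟩, ?_⟩
    · rw [mem_sphere_zero_iff_norm, norm_smul, norm_inv, norm_norm, inv_mul_cancel₀ p1.ne']
    · rw [mem_ball, Subtype.dist_eq, dist_eq_norm]; exact p3
    · simp only [smul_eq_mul]; rw [smul_smul, mul_inv_cancel₀ p1.ne', one_smul]
  have hvol : volume box ≤ volume (Ioo (0:ℝ) 1 • ((↑) '' ball u s : Set (EuclideanSpace ℝ (Fin (m+1))))) := by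
    rw [← mp.measure_preimage hbm.nullMeasurableSet]
    exact measure_mono hsub
  have hsph : ENNReal.ofReal ((m+1) * (1/4 * (s / (2 * (m+1))) ^ m)) ≤ sphMeasure (m+1) (ball u s) := by
    rw [sphMeasure, Measure.toSphere_apply' _ measurableSet_ball, ENNReal.ofReal_mul (by positivity), ← hbv]
    have : ENNReal.ofReal ((m:ℝ)+1) = (Module.finrank ℝ (EuclideanSpace ℝ (Fin (m+1))) : ENNReal) := by
      rw [finrank_euclideanSpace_fin, ← ENNReal.ofReal_natCast]; push_cast; rfl
    rw [this]; gcongr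
  have hfin : sphMeasure (m+1) (ball u s) ≠ ⊤ := by
    unfold sphMeasure; exact measure_ne_top _ _
  rw [measureReal_def, ← ENNReal.ofReal_le_iff_le_toReal hfin]
  refine le_trans (le_of_eq ?_) hsph
  congr 1
  rw [mul_assoc, mul_assoc, ← mul_pow]; congr 3; ring

end P8


section P9
variable {n : ℕ} {K : Set (EuclideanSpace ℝ (Fin n))}

instance sph_fin : IsFiniteMeasure (sphMeasure n) := by unfold sphMeasure; infer_instance

lemma int_cont {f : sphere (0 : EuclideanSpace ℝ (Fin n)) 1 → ℝ} (hf : Continuous f) :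
    Integrable f (sphMeasure n) :=
  hf.integrable_of_hasCompactSupport (HasCompactSupport.of_compactSpace f)

lemma vol_pos : 0 < vol (unitBall n) := by
  unfold vol unitBall
  exact ENNReal.toReal_pos (measure_closedBall_pos _ _ one_pos).ne' (measure_closedBall_lt_top).ne

lemma sph_univ (hn : 1 ≤ n) : (sphMeasure n).real univ = n * vol (unitBall n) := by
  haveI : Nonempty (Fin n) := ⟨⟨0, hn⟩⟩
  unfold sphMeasure vol unitBall
  rw [Measure.toSphere_real_apply_univ, finrank_euclideanSpace_fin, Measure.real,
    Measure.addHaar_closedBall_eq_addHaar_ball]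

lemma body_ne (hK : IsConvexBody K) : K.Nonempty := hK.2.2.mono interior_subset

lemma h_cont (hK : IsConvexBody K) (x : EuclideanSpace ℝ (Fin n)) :
    Continuous fun u : sphere (0 : EuclideanSpace ℝ (Fin n)) 1 => supp K u - ⟪x, (u : EuclideanSpace ℝ (Fin n))⟫ := by
  have := (supp_cont hK.1 (body_ne hK)).comp (continuous_subtype_val (p := (· ∈ sphere (0 : EuclideanSpace ℝ (Fin n)) 1)))
  exact this.sub (by fun_prop)

lemma h_pos (hK : IsConvexBody K) {x : EuclideanSpace ℝ (Fin n)} (hx : x ∈ interior K)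
    (u : sphere (0 : EuclideanSpace ℝ (Fin n)) 1) : 0 < supp K u - ⟪x, (u : EuclideanSpace ℝ (Fin n))⟫ := by
  obtain ⟨ρ, hρ, h⟩ := supp_pos hK.1 hx
  have := h u
  have hu : ‖(u : EuclideanSpace ℝ (Fin n))‖ = 1 := by simp
  rw [hu] at this
  linarith

lemma h_le (hK : IsConvexBody K) {x : EuclideanSpace ℝ (Fin n)} {R : ℝ} (hR : ∀ y ∈ K, ‖y - x‖ ≤ R)
    (u : sphere (0 : EuclideanSpace ℝ (Fin n)) 1) : supp K u - ⟪x, (u : EuclideanSpace ℝ (Fin n))⟫ ≤ R := by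
  obtain ⟨y, hy, e⟩ := exists_supp hK.1 (body_ne hK) (u : EuclideanSpace ℝ (Fin n))
  have hu : ‖(u : EuclideanSpace ℝ (Fin n))‖ = 1 := by simp
  have h1 := real_inner_le_norm (y - x) (u : EuclideanSpace ℝ (Fin n))
  rw [inner_sub_left, hu, mul_one] at h1
  have := hR y hy
  linarith

lemma entropy_ge (hK : IsConvexBody K) {x : EuclideanSpace ℝ (Fin n)} (hx : x ∈ interior K) :
    ∫ u, Real.log (supp K u - ⟪x, (u : EuclideanSpace ℝ (Fin n))⟫) ∂(sphMeasure n) ≤ entropy K := by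
  refine le_csSup ?_ ⟨x, hx, rfl⟩
  obtain ⟨R, hR⟩ := hK.1.isBounded.subset_closedBall (0 : EuclideanSpace ℝ (Fin n))
  refine ⟨∫ u, (2 * R) ∂(sphMeasure n), ?_⟩
  rintro _ ⟨y, hy, rfl⟩
  refine integral_mono (int_cont ((h_cont hK y).log fun u => (h_pos hK hy u).ne')) (integrable_const _) fun u => ?_
  have h1 := Real.log_le_sub_one_of_pos (h_pos hK hy u)
  have h2 := h_le hK (x := y) (R := 2 * R) (fun z hz => by
    have a := hR hz
    have b := hR (interior_subset hy)
    rw [mem_closedBall, dist_zero_right] at a b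
    linarith [norm_sub_le z y]) u
  simp only
  linarith

lemma bern {a : ℝ} (ha : 0 < a) (hn : 2 ≤ n) : a ^ 2 ≤ 2 / n * a ^ n + (1 - 2 / n) := by
  have hn' : (2:ℝ) ≤ n := by exact_mod_cast hn
  have h := one_add_mul_self_le_rpow_one_add (s := a ^ 2 - 1) (by nlinarith [sq_nonneg a]) (p := n / 2) (by linarith)
  have e : (1 + (a ^ 2 - 1)) ^ ((n:ℝ) / 2) = a ^ n := by
    rw [add_sub_cancel, ← Real.rpow_natCast a 2, ← Real.rpow_mul ha.le, ← Real.rpow_natCast a n]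
    congr 1; push_cast; ring
  rw [e] at h
  have : a ^ 2 = 2 / n * (1 + n / 2 * (a ^ 2 - 1)) + (1 - 2 / n) := by field_simp; ring
  rw [this]
  gcongr

lemma rpow_m2 {a : ℝ} (ha : 0 < a) : a ^ (-2 : ℝ) = (a⁻¹) ^ 2 := by
  rw [Real.rpow_neg ha.le, inv_pow]; norm_cast

lemma vol_eq (hK : IsConvexBody K) (hV : vol K = vol (unitBall n)) : volume K = volume (closedBall (0 : EuclideanSpace ℝ (Fin n)) 1) := by
  unfold vol unitBall at hV
  exact (ENNReal.toReal_eq_toReal_iff' hK.1.measure_lt_top.ne measure_closedBall_lt_top.ne).1 hV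

lemma hinv_cont (hK : IsConvexBody K) {x : EuclideanSpace ℝ (Fin n)} (hx : x ∈ interior K) :
    Continuous fun u : sphere (0 : EuclideanSpace ℝ (Fin n)) 1 => (supp K u - ⟪x, (u : EuclideanSpace ℝ (Fin n))⟫)⁻¹ :=
  (h_cont hK x).inv₀ fun u => (h_pos hK hx u).ne'

lemma int_sq_le (hn : 2 ≤ n) (hK : IsConvexBody K) (hV : vol K = vol (unitBall n))
    {e₂ : EuclideanSpace ℝ (Fin n)} 
    (hmin : ∀ x ∈ interior K,
              (∫ u, (supp K u - ⟪e₂, (u : EuclideanSpace ℝ (Fin n))⟫) ^ (-2 : ℝ)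
                  ∂(sphMeasure n))
                ≤ ∫ u, (supp K u - ⟪x, (u : EuclideanSpace ℝ (Fin n))⟫) ^ (-2 : ℝ)
                    ∂(sphMeasure n)) :
    (∫ u, (supp K u - ⟪e₂, (u : EuclideanSpace ℝ (Fin n))⟫) ^ (-2 : ℝ)
                  ∂(sphMeasure n)) ≤ (sphMeasure n).real univ := by
  obtain ⟨c, hc, hb⟩ := bs_body (by omega) hK (vol_eq hK hV)
  refine (hmin c hc).trans ?_
  have hn' : (2:ℝ) ≤ n := by exact_mod_cast hn
  have hI : Integrable (fun u : sphere (0 : EuclideanSpace ℝ (Fin n)) 1 => (supp K u - ⟪c, (u : EuclideanSpace ℝ (Fin n))⟫)⁻¹ ^ n) (sphMeasure n) :=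
    int_cont ((hinv_cont hK hc).pow n)
  have h1 : ∫ u, (supp K u - ⟪c, (u : EuclideanSpace ℝ (Fin n))⟫)⁻¹ ^ n ∂(sphMeasure n) ≤ (sphMeasure n).real univ := by
    rw [← ofReal_integral_eq_lintegral_ofReal hI (Filter.Eventually.of_forall fun u => by
      have := h_pos hK hc u
      positivity)] at hb
    rw [Measure.real]
    exact (ENNReal.ofReal_le_iff_le_toReal (measure_ne_top _ _)).1 hb
  calc _ ≤ ∫ u, (2 / n * (supp K u - ⟪c, (u : EuclideanSpace ℝ (Fin n))⟫)⁻¹ ^ n + (1 - 2 / n)) ∂(sphMeasure n) := by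
        refine integral_mono (int_cont ?_) ((hI.const_mul _).add (integrable_const _)) fun u => ?_
        · exact (h_cont hK c).rpow_const fun u => Or.inl (h_pos hK hc u).ne'
        · simp only
          rw [rpow_m2 (h_pos hK hc u)]
          exact bern (inv_pos.2 (h_pos hK hc u)) hn
    _ = 2 / n * (∫ u, (supp K u - ⟪c, (u : EuclideanSpace ℝ (Fin n))⟫)⁻¹ ^ n ∂(sphMeasure n)) + (1 - 2 / n) * (sphMeasure n).real univ := by
        rw [integral_add (hI.const_mul _) (integrable_const _), integral_const_mul, integral_const, smul_eq_mul, mul_comm (Measure.real _ _)]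
    _ ≤ 2 / n * (sphMeasure n).real univ + (1 - 2 / n) * (sphMeasure n).real univ := by
        gcongr
    _ = _ := by ring

lemma phi_ge {y : ℝ} (hy : 0 < y) : 1/2 * (y⁻¹ - 1) ^ 2 ≤ Real.log y + (y ^ (-2:ℝ) - 1) / 2 := by
  rw [rpow_m2 hy]
  have := Real.log_le_sub_one_of_pos (inv_pos.2 hy)
  rw [Real.log_inv] at this
  nlinarith

lemma l2_bound (hK : IsConvexBody K) {e₂ : EuclideanSpace ℝ (Fin n)} (he : e₂ ∈ interior K)
    (h2 : (∫ u, (supp K u - ⟪e₂, (u : EuclideanSpace ℝ (Fin n))⟫) ^ (-2 : ℝ)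
                  ∂(sphMeasure n)) ≤ (sphMeasure n).real univ) :
    ∫ u, ((supp K u - ⟪e₂, (u : EuclideanSpace ℝ (Fin n))⟫)⁻¹ - 1) ^ 2 ∂(sphMeasure n) ≤ 2 * entropy K := by
  have i1 : Integrable (fun u : sphere (0 : EuclideanSpace ℝ (Fin n)) 1 => Real.log (supp K u - ⟪e₂, (u : EuclideanSpace ℝ (Fin n))⟫)) (sphMeasure n) :=
    int_cont ((h_cont hK e₂).log fun u => (h_pos hK he u).ne')
  have i2 : Integrable (fun u : sphere (0 : EuclideanSpace ℝ (Fin n)) 1 => (supp K u - ⟪e₂, (u : EuclideanSpace ℝ (Fin n))⟫) ^ (-2:ℝ)) (sphMeasure n) :=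
    int_cont ((h_cont hK e₂).rpow_const fun u => Or.inl (h_pos hK he u).ne')
  have i3 : Integrable (fun u : sphere (0 : EuclideanSpace ℝ (Fin n)) 1 => ((supp K u - ⟪e₂, (u : EuclideanSpace ℝ (Fin n))⟫)⁻¹ - 1) ^ 2) (sphMeasure n) :=
    int_cont (((hinv_cont hK he).sub continuous_const).pow 2)
  have i4 : Integrable (fun u : sphere (0 : EuclideanSpace ℝ (Fin n)) 1 => ((supp K u - ⟪e₂, (u : EuclideanSpace ℝ (Fin n))⟫) ^ (-2:ℝ) - 1) / 2) (sphMeasure n) :=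
    (i2.sub (integrable_const 1)).div_const 2
  have h3 := integral_mono (i3.const_mul (1/2)) (i1.add i4) fun u => phi_ge (h_pos hK he u)
  rw [integral_const_mul] at h3
  simp only [Pi.add_apply, Pi.sub_apply] at h3
  rw [integral_add i1 i4, integral_div] at h3
  rw [integral_sub i2 (integrable_const _), integral_const, smul_eq_mul, mul_one] at h3
  have := entropy_ge hK he
  linarith

lemma neg_log_le {q : ℝ} (hq : 0 < q) : -(2 * q ^ (-(1/2) : ℝ)) ≤ Real.log q := by
  have h := Real.log_le_sub_one_of_pos (Real.rpow_pos_of_pos hq (-(1/2) : ℝ))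
  rw [Real.log_rpow hq] at h
  linarith

end P9


section P10
variable {m : ℕ}

lemma diam_bound : ∃ C₁ : ℝ, 0 < C₁ ∧ ∀ K : Set (EuclideanSpace ℝ (Fin (m+1))), IsConvexBody K →
    ∀ ε : ℝ, entropy K ≤ ε → ∀ a ∈ K, ∀ b ∈ K,
      ‖a - b‖ ≤ C₁ * Real.exp (ε / (sphMeasure (m+1)).real univ) := by
  obtain ⟨M, hM, hs⟩ := sing_sphere (m := m)
  set ω := (sphMeasure (m+1)).real univ with hω
  have hω0 : 0 < ω := by
    rw [hω, sph_univ (by omega)]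
    exact mul_pos (by positivity) vol_pos
  refine ⟨4 * Real.exp (2 * M / ω), by positivity, fun K hK ε hε a ha b hb => ?_⟩
  by_cases hab : a = b
  · rw [hab]; simp; positivity
  set D := ‖a - b‖ with hD
  have hD0 : 0 < D := norm_pos_iff.2 (sub_ne_zero.2 hab)
  obtain ⟨x0, hx0⟩ := hK.2.2
  set p := (1/2 : ℝ) • ((1/2 : ℝ) • a + (1/2 : ℝ) • b) + (1/2 : ℝ) • x0 with hp
  have hpi : p ∈ interior K :=
    hK.2.1.combo_self_interior_mem_interior (hK.2.1 ha hb (by norm_num) (by norm_num) (by norm_num)) hx0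
      (by norm_num) (by norm_num) (by norm_num)
  set w := D⁻¹ • (a - b) with hw
  have hw1 : ‖w‖ = 1 := by rw [hw, norm_smul, norm_inv, norm_norm, ← hD, inv_mul_cancel₀ hD0.ne']
  set q : sphere (0 : EuclideanSpace ℝ (Fin (m+1))) 1 → ℝ := fun u => 4 / D * (supp K u - ⟪p, (u : EuclideanSpace ℝ (Fin (m+1)))⟫) with hq
  have hq0 : ∀ u, 0 < q u := fun u => mul_pos (by positivity) (h_pos hK hpi u)
  have hqc : Continuous q := continuous_const.mul (h_cont hK p)
  have hqw : ∀ u : sphere (0 : EuclideanSpace ℝ (Fin (m+1))) 1, |⟪w, (u : EuclideanSpace ℝ (Fin (m+1)))⟫| ≤ q u := by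
    intro u
    have h1 := le_supp hK.1 ha (u : EuclideanSpace ℝ (Fin (m+1)))
    have h2 := le_supp hK.1 hb (u : EuclideanSpace ℝ (Fin (m+1)))
    have h3 := le_supp hK.1 (interior_subset hx0) (u : EuclideanSpace ℝ (Fin (m+1)))
    have e1 : ⟪w, (u : EuclideanSpace ℝ (Fin (m+1)))⟫ = 4 / D * ((⟪a, (u : EuclideanSpace ℝ (Fin (m+1)))⟫ - ⟪b, (u : EuclideanSpace ℝ (Fin (m+1)))⟫) / 4) := by
      rw [hw, real_inner_smul_left, inner_sub_left]; field_simp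
    have e2 : ⟪p, (u : EuclideanSpace ℝ (Fin (m+1)))⟫ = (⟪a, (u : EuclideanSpace ℝ (Fin (m+1)))⟫ + ⟪b, (u : EuclideanSpace ℝ (Fin (m+1)))⟫) / 4 + ⟪x0, (u : EuclideanSpace ℝ (Fin (m+1)))⟫ / 2 := by
      rw [hp, inner_add_left, real_inner_smul_left, inner_add_left, real_inner_smul_left, real_inner_smul_left, real_inner_smul_left]; ring
    rw [e1, abs_mul, abs_of_pos (by positivity : 0 < 4 / D)]
    simp only [hq]
    refine mul_le_mul_of_nonneg_left ?_ (by positivity)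
    rw [e2, abs_le]
    constructor <;> linarith
  have iq : Integrable (fun u => q u ^ (-(1/2) : ℝ)) (sphMeasure (m+1)) :=
    int_cont (hqc.rpow_const fun u => Or.inl (hq0 u).ne')
  have h1 : ∫ u, q u ^ (-(1/2) : ℝ) ∂(sphMeasure (m+1)) ≤ M := by
    rw [← ENNReal.ofReal_le_ofReal_iff hM.le, ofReal_integral_eq_lintegral_ofReal iq
      (Filter.Eventually.of_forall fun u => (Real.rpow_pos_of_pos (hq0 u) _).le)]
    refine (lintegral_mono fun u => ?_).trans (hs w hw1)
    rw [← ENNReal.ofReal_rpow_of_pos (hq0 u), ENNReal.rpow_neg, ENNReal.rpow_neg]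
    exact ENNReal.inv_le_inv.2 (ENNReal.rpow_le_rpow (ENNReal.ofReal_le_ofReal (hqw u)) (by norm_num))
  have il : Integrable (fun u => Real.log (q u)) (sphMeasure (m+1)) :=
    int_cont (hqc.log fun u => (hq0 u).ne')
  have h2 : -(2 * M) ≤ ∫ u, Real.log (q u) ∂(sphMeasure (m+1)) := by
    have := integral_mono ((iq.const_mul 2).neg) il fun u => neg_log_le (hq0 u)
    simp only [Pi.neg_apply] at this
    rw [integral_neg, integral_const_mul] at this
    linarith
  have h3 : ∫ u, Real.log (q u) ∂(sphMeasure (m+1)) = Real.log (4 / D) * ω +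
      ∫ u, Real.log (supp K u - ⟪p, (u : EuclideanSpace ℝ (Fin (m+1)))⟫) ∂(sphMeasure (m+1)) := by
    rw [mul_comm, ← smul_eq_mul, hω, ← integral_const, ← integral_add (integrable_const _)
      (int_cont ((h_cont hK p).log fun u => (h_pos hK hpi u).ne'))]
    refine integral_congr_ae (Filter.Eventually.of_forall fun u => ?_)
    exact Real.log_mul (by positivity) (h_pos hK hpi u).ne'
  have h4 := entropy_ge hK hpi
  have h5 : Real.log (D / 4) * ω ≤ ε + 2 * M := by
    have : Real.log (4 / D) = - Real.log (D / 4) := by rw [← Real.log_inv, inv_div]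
    rw [this] at h3
    linarith
  rw [← le_div_iff₀ hω0, Real.log_le_iff_le_exp (by positivity)] at h5
  rw [mul_assoc, ← Real.exp_add, ← add_div, add_comm (2 * M)]
  linarith

lemma supp_ball (u : sphere (0 : EuclideanSpace ℝ (Fin (m+1))) 1) :
    supp (closedBall (0 : EuclideanSpace ℝ (Fin (m+1))) 1) (u : EuclideanSpace ℝ (Fin (m+1))) = 1 := by
  have hu : ‖(u : EuclideanSpace ℝ (Fin (m+1)))‖ = 1 := by simp
  refine le_antisymm ?_ ?_
  · obtain ⟨y, hy, e⟩ := exists_supp (isCompact_closedBall (0 : EuclideanSpace ℝ (Fin (m+1))) 1) ⟨0, by simp⟩ (u : EuclideanSpace ℝ (Fin (m+1)))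
    have := real_inner_le_norm y (u : EuclideanSpace ℝ (Fin (m+1)))
    rw [mem_closedBall, dist_zero_right] at hy
    rw [hu, mul_one] at this
    linarith
  · have := le_supp (isCompact_closedBall (0 : EuclideanSpace ℝ (Fin (m+1))) 1) (x := u) (by simp) (u : EuclideanSpace ℝ (Fin (m+1)))
    rwa [real_inner_self_eq_norm_sq, hu, one_pow] at this

instance sph_ne : Nonempty (sphere (0 : EuclideanSpace ℝ (Fin (m+1))) 1) :=
  (NormedSpace.sphere_nonempty.2 zero_le_one).to_subtype

lemma hdist_pow_le {K : Set (EuclideanSpace ℝ (Fin (m+1)))} (hK : IsConvexBody K) (e : EuclideanSpace ℝ (Fin (m+1))) {X : ℝ} {k : ℕ}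
    (h : ∀ u : sphere (0 : EuclideanSpace ℝ (Fin (m+1))) 1, |supp K u - ⟪e, (u : EuclideanSpace ℝ (Fin (m+1)))⟫ - 1| ^ k ≤ X) :
    hdist ((fun x => x - e) '' K) (closedBall 0 1) ^ k ≤ X := by
  have hc : Continuous fun u : sphere (0 : EuclideanSpace ℝ (Fin (m+1))) 1 => |supp K u - ⟪e, (u : EuclideanSpace ℝ (Fin (m+1)))⟫ - 1| :=
    ((h_cont hK e).sub continuous_const).abs
  obtain ⟨u0, -, hu0⟩ := isCompact_univ.exists_isMaxOn univ_nonempty hc.continuousOn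
  refine le_trans (pow_le_pow_left₀ (Real.iSup_nonneg fun u => abs_nonneg _) (ciSup_le fun u => ?_) k) (h u0)
  rw [supp_sub hK.1 (body_ne hK), supp_ball]
  exact hu0 (mem_univ u)

lemma exp_low {t : ℝ} (h0 : 0 ≤ t) (h1 : t ≤ 1) : t ≤ 2 * (1 - Real.exp (-t)) := by
  have : Real.exp (-t) ≤ 1 - t / 2 := by
    have h := Real.add_one_le_exp t
    rw [Real.exp_neg]
    rw [inv_le_comm₀ (Real.exp_pos t) (by linarith)]
    refine le_trans ?_ h
    rw [inv_le_iff_one_le_mul₀ (by linarith)]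
    nlinarith
  linarith

lemma main_bound : ∃ A : ℝ, 0 < A ∧ ∀ K : Set (EuclideanSpace ℝ (Fin (m+1))), IsConvexBody K →
    ∀ ε : ℝ, entropy K ≤ ε → ∀ e₂ ∈ interior K,
    (∫ u, (supp K u - ⟪e₂, (u : EuclideanSpace ℝ (Fin (m+1)))⟫) ^ (-2 : ℝ)
                  ∂(sphMeasure (m+1))) ≤ (sphMeasure (m+1)).real univ →
    0 ≤ ε ∧ ∀ u : sphere (0 : EuclideanSpace ℝ (Fin (m+1))) 1,
      |supp K u - ⟪e₂, (u : EuclideanSpace ℝ (Fin (m+1)))⟫ - 1| ^ (m + 2) ≤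
        A * Real.exp ((m + 2) * (ε / (sphMeasure (m+1)).real univ)) * (1 - Real.exp (-(ε / (sphMeasure (m+1)).real univ))) := by
  obtain ⟨C₁, hC, hd⟩ := diam_bound (m := m)
  obtain ⟨c, hc, hcap⟩ := cap_bound (m := m)
  set ω := (sphMeasure (m+1)).real univ with hω
  have hω0 : 0 < ω := by
    rw [hω, sph_univ (by omega)]
    exact mul_pos (by positivity) vol_pos
  set R := C₁ * Real.exp 1 with hR
  have hR0 : 0 < R := by positivity
  set A1 := 2 * (C₁ + 1) ^ (m + 2) with hA1
  set A2 := 16 * R ^ 2 * ω * (2 * (R + 1)) ^ m / c with hA2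
  have hA10 : 0 < A1 := by positivity
  have hA20 : 0 < A2 := by positivity
  refine ⟨A1 + A2, by positivity, fun K hK ε hε e he h2 => ?_⟩
  have hl2 := l2_bound hK he h2
  have hε0 : 0 ≤ ε := by
    have : 0 ≤ ∫ u, ((supp K u - ⟪e, (u : EuclideanSpace ℝ (Fin (m+1)))⟫)⁻¹ - 1) ^ 2 ∂(sphMeasure (m+1)) :=
      integral_nonneg fun u => sq_nonneg _
    linarith
  refine ⟨hε0, fun u => ?_⟩
  set t := ε / ω with ht
  have ht0 : 0 ≤ t := by positivity
  have hdK : ∀ y ∈ K, ‖y - e‖ ≤ C₁ * Real.exp t := fun y hy => hd K hK ε hε y hy e (interior_subset he)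
  have hh := h_le hK hdK
  have hp := h_pos hK he
  have hexp : Real.exp ((m + 2) * t) = Real.exp t ^ (m + 2) := by
    rw [← Real.exp_nat_mul]; push_cast; rfl
  have he1 : 1 ≤ Real.exp t := Real.one_le_exp ht0
  have hlow : 0 ≤ 1 - Real.exp (-t) := by
    have := Real.exp_le_one_iff.2 (neg_nonpos.2 ht0); linarith
  rcases le_or_gt 1 t with h1 | h1
  · have hb : |supp K u - ⟪e, (u : EuclideanSpace ℝ (Fin (m+1)))⟫ - 1| ≤ (C₁ + 1) * Real.exp t := by
      have a := hh u
      have b := hp u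
      rw [abs_le]
      constructor <;> nlinarith
    have hhalf : 1 ≤ 2 * (1 - Real.exp (-t)) := by
      have := exp_low zero_le_one le_rfl
      have h' : Real.exp (-t) ≤ Real.exp (-1) := Real.exp_le_exp.2 (by linarith)
      linarith
    calc _ ≤ ((C₁ + 1) * Real.exp t) ^ (m + 2) := pow_le_pow_left₀ (abs_nonneg _) hb _
      _ = (C₁ + 1) ^ (m + 2) * Real.exp ((m + 2) * t) * 1 := by rw [mul_pow, hexp, mul_one]
      _ ≤ (C₁ + 1) ^ (m + 2) * Real.exp ((m + 2) * t) * (2 * (1 - Real.exp (-t))) := by gcongr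
      _ = A1 * Real.exp ((m + 2) * t) * (1 - Real.exp (-t)) := by rw [hA1]; ring
      _ ≤ _ := by gcongr; linarith
  · have hRt : C₁ * Real.exp t ≤ R := by rw [hR]; gcongr
    have hhR : ∀ v : sphere (0 : EuclideanSpace ℝ (Fin (m+1))) 1, supp K v - ⟪e, (v : EuclideanSpace ℝ (Fin (m+1)))⟫ ≤ R := fun v => (hh v).trans hRt
    have hKR : K ⊆ closedBall e R := fun y hy => by
      rw [mem_closedBall, dist_eq_norm]; exact (hdK y hy).trans hRt
    set δ := |supp K u - ⟪e, (u : EuclideanSpace ℝ (Fin (m+1)))⟫ - 1| with hδ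
    suffices hs : δ ^ (m + 2) ≤ A2 / 2 * t by
      calc δ ^ (m + 2) ≤ A2 / 2 * t := hs
        _ ≤ A2 / 2 * (2 * (1 - Real.exp (-t))) := by gcongr; exact exp_low ht0 h1.le
        _ = A2 * 1 * (1 - Real.exp (-t)) := by ring
        _ ≤ (A1 + A2) * Real.exp ((m + 2) * t) * (1 - Real.exp (-t)) := by
            gcongr
            · linarith
            · exact Real.one_le_exp (by positivity)
    have hδn : 0 ≤ δ := abs_nonneg _
    rcases hδn.eq_or_lt with hz | hδ0
    · rw [← hz]; simp; positivity
    have hδR : δ ≤ R + 1 := by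
      have a := hhR u
      have b := hp u
      rw [hδ, abs_le]; constructor <;> linarith
    set s := δ / (2 * (R + 1)) with hs
    have hs0 : 0 < s := by positivity
    have hs1 : s ≤ 1 := by rw [hs, div_le_one (by positivity)]; linarith
    have hI : Integrable (fun v : sphere (0 : EuclideanSpace ℝ (Fin (m+1))) 1 => (supp K v - ⟪e, (v : EuclideanSpace ℝ (Fin (m+1)))⟫ - 1) ^ 2) (sphMeasure (m+1)) :=
      int_cont (((h_cont hK e).sub continuous_const).pow 2)
    have hup : ∫ v, (supp K v - ⟪e, (v : EuclideanSpace ℝ (Fin (m+1)))⟫ - 1) ^ 2 ∂(sphMeasure (m+1)) ≤ R ^ 2 * (2 * ε) := by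
      refine le_trans ?_ (mul_le_mul_of_nonneg_left (hl2.trans (by linarith : 2 * entropy K ≤ 2 * ε)) (by positivity))
      rw [← integral_const_mul]
      refine integral_mono hI ((int_cont (((hinv_cont hK he).sub continuous_const).pow 2)).const_mul _) fun v => ?_
      have b := hp v
      have a := hhR v
      simp only
      rw [← mul_pow]
      refine sq_le_sq.2 ?_
      rw [abs_mul, abs_of_pos hR0]
      have : supp K v - ⟪e, (v : EuclideanSpace ℝ (Fin (m+1)))⟫ - 1 = (supp K v - ⟪e, (v : EuclideanSpace ℝ (Fin (m+1)))⟫) * (-((supp K v - ⟪e, (v : EuclideanSpace ℝ (Fin (m+1)))⟫)⁻¹ - 1)) := by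
        field_simp; ring
      rw [this, abs_mul, abs_neg, abs_of_pos b]
      gcongr
    have hlo : (δ / 2) ^ 2 * (sphMeasure (m+1)).real (ball u s) ≤ ∫ v, (supp K v - ⟪e, (v : EuclideanSpace ℝ (Fin (m+1)))⟫ - 1) ^ 2 ∂(sphMeasure (m+1)) := by
      refine le_trans ?_ (setIntegral_le_integral (s := ball u s) hI (Filter.Eventually.of_forall fun v => sq_nonneg _))
      have hk := setIntegral_mono_on (μ := sphMeasure (m+1)) (s := ball u s) (f := fun _ => (δ / 2) ^ 2) (integrableOn_const (measure_ne_top _ _)) hI.integrableOn measurableSet_ball (fun v hv => ?_)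
      · rw [setIntegral_const, smul_eq_mul, mul_comm] at hk
        exact hk
      · have hl := supp_lip hK.1 (body_ne hK) hKR (u : EuclideanSpace ℝ (Fin (m+1))) (v : EuclideanSpace ℝ (Fin (m+1)))
        rw [mem_ball, Subtype.dist_eq, dist_eq_norm, norm_sub_rev] at hv
        have h3 : R * s ≤ δ / 2 := by
          rw [hs]
          rw [mul_div_assoc', div_le_div_iff₀ (by positivity) (by norm_num)]
          nlinarith
        have h4 : |supp K u - ⟪e, (u : EuclideanSpace ℝ (Fin (m+1)))⟫ - (supp K v - ⟪e, (v : EuclideanSpace ℝ (Fin (m+1)))⟫)| ≤ δ / 2 :=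
          hl.trans (le_trans (by gcongr) h3)
        rw [← sq_abs (supp K v - _ - 1)]
        refine pow_le_pow_left₀ (by positivity) ?_ 2
        have h5 := abs_add_le (supp K u - ⟪e, (u : EuclideanSpace ℝ (Fin (m+1)))⟫ - (supp K v - ⟪e, (v : EuclideanSpace ℝ (Fin (m+1)))⟫)) (supp K v - ⟪e, (v : EuclideanSpace ℝ (Fin (m+1)))⟫ - 1)
        rw [sub_add_sub_cancel] at h5
        linarith
    have h6 : (δ / 2) ^ 2 * (c * s ^ m) ≤ R ^ 2 * (2 * ε) :=
      le_trans (mul_le_mul_of_nonneg_left (hcap u s hs0 hs1) (by positivity)) (hlo.trans hup)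
    have h7 : ε = ω * t := by rw [ht]; field_simp
    have h8 : δ = s * (2 * (R + 1)) := by rw [hs]; field_simp
    have h9 : A2 / 2 * t = R ^ 2 * (2 * ε) * (4 * (2 * (R + 1)) ^ m / c) := by
      rw [hA2, h7]; field_simp; ring
    rw [h9]
    calc δ ^ (m + 2) = (δ / 2) ^ 2 * (c * s ^ m) * (4 * (2 * (R + 1)) ^ m / c) := by
          rw [pow_add]; nth_rewrite 1 [h8]; rw [mul_pow]; field_simp; ring
      _ ≤ _ := by gcongr

end P10


section P11

lemma beta_nonneg (a b : ℝ) : 0 ≤ betaInt a b := by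
  unfold betaInt
  refine intervalIntegral.integral_nonneg zero_le_one fun t ht => ?_
  exact mul_nonneg (Real.rpow_nonneg ht.1 _) (Real.rpow_nonneg (by linarith [ht.2]) _)

lemma beta_pos {a b : ℝ} (ha : 0 < a) (hb : 0 < b) : 0 < betaInt a b := by
  unfold betaInt
  refine intervalIntegral.intervalIntegral_pos_of_pos_on ?_ (fun t ht => ?_) zero_lt_one
  · have h := Complex.betaIntegral_convergent (u := (a : ℂ)) (v := (b : ℂ)) (by simpa using ha) (by simpa using hb)
    rw [intervalIntegrable_iff_integrableOn_Ioo_of_le zero_le_one] at h ⊢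
    refine IntegrableOn.congr_fun (Integrable.norm h) (fun t ht => ?_) measurableSet_Ioo
    have h1 : (0:ℝ) < 1 - t := by linarith [ht.2]
    rw [norm_mul, ← Complex.ofReal_one, ← Complex.ofReal_sub, ← Complex.ofReal_sub, ← Complex.ofReal_sub,
      Complex.norm_cpow_eq_rpow_re_of_pos ht.1, Complex.norm_cpow_eq_rpow_re_of_pos h1]
    simp
  · exact mul_pos (Real.rpow_pos_of_pos ht.1 _) (Real.rpow_pos_of_pos (by linarith [ht.2]) _)

lemma alpha_nonneg (n : ℕ) : 0 ≤ alphaConst n := by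
  unfold alphaConst
  exact div_nonneg (mul_nonneg (mul_nonneg (Nat.cast_nonneg _) vol_pos.le) (beta_nonneg _ _)) (beta_nonneg _ _)

lemma alpha_pos {n : ℕ} (hn : 2 ≤ n) : 0 < alphaConst n := by
  have hn' : (2:ℝ) ≤ n := by exact_mod_cast hn
  unfold alphaConst
  exact div_pos (mul_pos (mul_pos (by linarith) vol_pos) (beta_pos (by norm_num) (by linarith)))
    (beta_pos (by norm_num) (by linarith))

lemma sph_neg (n : ℕ) : MeasurePreserving (fun u : sphere (0 : EuclideanSpace ℝ (Fin n)) 1 => -u) (sphMeasure n) (sphMeasure n) := by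
  have hm : Measurable (fun u : sphere (0 : EuclideanSpace ℝ (Fin n)) 1 => -u) := continuous_neg.measurable
  refine ⟨hm, ?_⟩
  ext s hs
  rw [Measure.map_apply hm hs]
  unfold sphMeasure
  rw [Measure.toSphere_apply' _ hs, Measure.toSphere_apply' _ (hm hs)]
  congr 1
  rw [← Measure.measure_neg volume (Ioo (0:ℝ) 1 • _)]
  congr 1
  ext x
  simp only [mem_neg, mem_smul, mem_image, mem_preimage]
  constructor
  · rintro ⟨r, hr, _, ⟨u, hu, rfl⟩, h⟩
    refine ⟨r, hr, _, ⟨-u, hu, rfl⟩, ?_⟩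
    simp only [coe_neg_sphere, smul_neg]
    rw [h, neg_neg]
  · rintro ⟨r, hr, _, ⟨u, hu, rfl⟩, h⟩
    refine ⟨r, hr, _, ⟨-u, by simpa using hu, rfl⟩, ?_⟩
    simp only [coe_neg_sphere, smul_neg]
    rw [h]

lemma int_lin_zero (n : ℕ) (d : EuclideanSpace ℝ (Fin n)) :
    ∫ u, ⟪d, ((u : sphere (0 : EuclideanSpace ℝ (Fin n)) 1) : EuclideanSpace ℝ (Fin n))⟫ ∂(sphMeasure n) = 0 := by
  have h := (sph_neg n).integral_comp (Homeomorph.neg _).measurableEmbedding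
    (fun u : sphere (0 : EuclideanSpace ℝ (Fin n)) 1 => ⟪d, (u : EuclideanSpace ℝ (Fin n))⟫)
  simp only [coe_neg_sphere, inner_neg_right, integral_neg] at h
  linarith

lemma norm1 (x : EuclideanSpace ℝ (Fin 1)) : ‖x‖ = |x 0| := by
  rw [EuclideanSpace.norm_eq]; simp [Real.sqrt_sq_eq_abs]

lemma body1 {K : Set (EuclideanSpace ℝ (Fin 1))} (hK : IsConvexBody K) (hV : vol K = vol (unitBall 1)) :
    ∃ c, K = closedBall c 1 := by
  set f : EuclideanSpace ℝ (Fin 1) → ℝ := fun x => x 0 with hf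
  have hfc : Continuous f := by fun_prop
  have hcn : IsConnected (f '' K) := (hK.2.1.isConnected (body_ne hK)).image f hfc.continuousOn
  have hIcc := eq_Icc_of_connected_compact hcn (hK.1.image hfc)
  set a := sInf (f '' K)
  set b := sSup (f '' K)
  have hab : a ≤ b := by
    obtain ⟨y, hy⟩ := hcn.nonempty
    rw [hIcc] at hy
    exact hy.1.trans hy.2
  have hball : K = closedBall (EuclideanSpace.single 0 ((a+b)/2)) ((b-a)/2) := by
    ext x
    rw [mem_closedBall, dist_eq_norm, norm1]
    have e : (x - (EuclideanSpace.single 0 ((a+b)/2) : EuclideanSpace ℝ (Fin 1))) 0 = x 0 - (a+b)/2 := by simp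
    rw [e, abs_le]
    have : x ∈ K ↔ x 0 ∈ f '' K := by
      constructor
      · intro h; exact ⟨x, h, rfl⟩
      · rintro ⟨y, hy, h⟩
        have : y = x := by
          ext i; rw [Subsingleton.elim i 0]; exact h
        rwa [← this]
    rw [this, hIcc, mem_Icc]
    constructor
    · rintro ⟨h1, h2⟩; constructor <;> linarith
    · rintro ⟨h1, h2⟩; constructor <;> linarith
  have hv := vol_eq hK hV
  rw [hball, Measure.addHaar_closedBall _ _ (by linarith), Measure.addHaar_closedBall _ _ zero_le_one] at hv
  have hne : volume (ball (0 : EuclideanSpace ℝ (Fin 1)) 1) ≠ 0 := (measure_ball_pos _ _ one_pos).ne'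
  have hnt : volume (ball (0 : EuclideanSpace ℝ (Fin 1)) 1) ≠ ⊤ := measure_ball_lt_top.ne
  rw [ENNReal.mul_left_inj hne hnt] at hv
  simp only [finrank_euclideanSpace_fin, pow_one] at hv
  rw [ENNReal.ofReal_eq_ofReal_iff (by linarith) zero_le_one] at hv
  rw [hv] at hball
  exact ⟨_, hball⟩

lemma case1 {K : Set (EuclideanSpace ℝ (Fin 1))} (hK : IsConvexBody K) (hV : vol K = vol (unitBall 1))
    {e₂ : EuclideanSpace ℝ (Fin 1)} (he : e₂ ∈ interior K)
    (hmin : ∀ x ∈ interior K,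
              (∫ u, (supp K u - ⟪e₂, (u : EuclideanSpace ℝ (Fin 1))⟫) ^ (-2 : ℝ)
                  ∂(sphMeasure 1))
                ≤ ∫ u, (supp K u - ⟪x, (u : EuclideanSpace ℝ (Fin 1))⟫) ^ (-2 : ℝ)
                    ∂(sphMeasure 1)) (u : sphere (0 : EuclideanSpace ℝ (Fin 1)) 1) :
    supp K u - ⟪e₂, (u : EuclideanSpace ℝ (Fin 1))⟫ = 1 := by
  obtain ⟨c, hc⟩ := body1 hK hV
  have hsc : ∀ v : sphere (0 : EuclideanSpace ℝ (Fin 1)) 1, supp K v - ⟪c, (v : EuclideanSpace ℝ (Fin 1))⟫ = 1 := by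
    intro v
    rw [← supp_sub hK.1 (body_ne hK)]
    have : (fun x => x - c) '' K = closedBall (0 : EuclideanSpace ℝ (Fin (0+1))) 1 := by
      rw [hc]
      ext x
      simp only [mem_image, mem_closedBall, dist_eq_norm, sub_zero]
      constructor
      · rintro ⟨y, hy, rfl⟩; exact hy
      · intro h; exact ⟨x + c, by simpa using h, by simp⟩
    rw [this]
    exact supp_ball v
  have hci : c ∈ interior K := by
    rw [hc]; exact ball_subset_interior_closedBall (mem_ball_self one_pos)
  have h1 := hmin c hci
  simp only [hsc, Real.one_rpow, integral_const, smul_eq_mul, mul_one] at h1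
  set h : sphere (0 : EuclideanSpace ℝ (Fin 1)) 1 → ℝ := fun u => supp K u - ⟪e₂, (u : EuclideanSpace ℝ (Fin 1))⟫ with hh
  have hp : ∀ v, 0 < h v := h_pos hK he
  have hcont : Continuous h := h_cont hK e₂
  have hlin : ∀ v, 1 - h v = ⟪e₂ - c, (v : EuclideanSpace ℝ (Fin 1))⟫ := by
    intro v
    have := hsc v
    simp only [hh]
    rw [inner_sub_left]; linarith
  have hz : ∫ v, (1 - h v) ∂(sphMeasure 1) = 0 := by
    simp only [hlin]; exact int_lin_zero 1 _
  -- the nonnegative defect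
  set g : sphere (0 : EuclideanSpace ℝ (Fin 1)) 1 → ℝ := fun v => (h v) ^ (-2:ℝ) - 1 - 2 * (1 - h v) with hg
  have hgform : ∀ v, g v = (1 - h v) ^ 2 * (1 + 2 * h v) / h v ^ 2 := by
    intro v
    have := hp v
    simp only [hg]
    rw [rpow_m2 this]
    field_simp; ring
  have hg0 : 0 ≤ g := fun v => by
    have := hp v
    rw [hgform, Pi.zero_apply]; positivity
  have i1 : Continuous fun v => (h v) ^ (-2:ℝ) := hcont.rpow_const fun v => Or.inl (hp v).ne'
  have hgc : Continuous g := (i1.sub continuous_const).sub (continuous_const.mul (continuous_const.sub hcont))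
  have j1 : Integrable (fun v => (h v) ^ (-2:ℝ) - 1) (sphMeasure 1) := int_cont (i1.sub continuous_const)
  have j2 : Integrable (fun v => 2 * (1 - h v)) (sphMeasure 1) := int_cont (continuous_const.mul (continuous_const.sub hcont))
  have hgi : ∫ v, g v ∂(sphMeasure 1) ≤ 0 := by
    simp only [hg]
    rw [integral_sub j1 j2,
      integral_sub (int_cont i1) (integrable_const _), integral_const_mul, hz]
    simp only [integral_const, smul_eq_mul, mul_one, mul_zero, sub_zero]
    linarith
  have hgz : ∫ v, g v ∂(sphMeasure 1) = 0 := le_antisymm hgi (integral_nonneg hg0)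
  rw [integral_eq_zero_iff_of_nonneg hg0 (int_cont hgc)] at hgz
  haveI : (sphMeasure 1).IsOpenPosMeasure := by unfold sphMeasure; infer_instance
  have hg00 : g = 0 := (hgc.ae_eq_iff_eq (sphMeasure 1) continuous_zero).1 hgz
  have := congrFun hg00 u
  rw [hgform, Pi.zero_apply] at this
  have hpu := hp u
  have h3 : (1 - h u) ^ 2 = 0 := by
    rcases div_eq_zero_iff.1 this with h' | h'
    · rcases mul_eq_zero.1 h' with h'' | h''
      · exact h''
      · linarith
    · exact absurd h' (by positivity)
  have h4 := pow_eq_zero_iff (two_ne_zero) |>.1 h3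
  show h u = 1
  linarith

end P11

/-- Lemma 3.3 of the paper. -/
theorem statement2 (n : ℕ) (hn : 1 ≤ n) :
    ∃ C : ℝ, 0 < C ∧
      ∀ K : Set (EuclideanSpace ℝ (Fin n)), IsConvexBody K →
        vol K = vol (unitBall n) →
        ∀ ε : ℝ, entropy K ≤ ε →
          ∀ e₂ ∈ interior K,
            (∀ x ∈ interior K,
              (∫ u, (supp K u - ⟪e₂, (u : EuclideanSpace ℝ (Fin n))⟫) ^ (-2 : ℝ)
                  ∂(sphMeasure n))
                ≤ ∫ u, (supp K u - ⟪x, (u : EuclideanSpace ℝ (Fin n))⟫) ^ (-2 : ℝ)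
                    ∂(sphMeasure n)) →
            ∃ r : ℝ, 1 ≤ r ∧ r ≤ Real.exp (ε / (n * vol (unitBall n))) ∧
              hdist ((fun x => x - e₂) '' K) (Metric.closedBall 0 r) ^ (n + 1)
                ≤ (2 * n * C ^ 2 * (C + 2) ^ (n - 1) * vol (unitBall n) / alphaConst n)
                    * Real.exp (((n : ℝ) + 1) * ε / (n * vol (unitBall n)))
                    * (1 - Real.exp (-ε / (n * vol (unitBall n)))) := by
  have hV0 : 0 < vol (unitBall n) := vol_pos
  have hn0 : (0:ℝ) < n := by exact_mod_cast hn
  rcases Nat.lt_or_ge n 2 with h2 | h2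
  · obtain rfl : n = 1 := by omega
    refine ⟨1, one_pos, fun K hK hV ε hε e he hmin => ?_⟩
    have hone := case1 hK hV he hmin
    have hε0 : 0 ≤ ε := by
      have := entropy_ge hK he
      simp only [hone, Real.log_one, integral_zero] at this
      linarith
    have ht0 : 0 ≤ ε / ((1:ℕ) * vol (unitBall 1)) := by positivity
    refine ⟨1, le_rfl, Real.one_le_exp ht0, ?_⟩
    refine hdist_pow_le (m := 0) hK e fun u => ?_
    have hu : supp K (u : EuclideanSpace ℝ (Fin 1)) - ⟪e, (u : EuclideanSpace ℝ (Fin 1))⟫ - 1 = 0 := by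
      rw [hone u]; simp
    have hz : |supp K (u : EuclideanSpace ℝ (Fin 1)) - ⟪e, (u : EuclideanSpace ℝ (Fin 1))⟫ - 1| ^ (1 + 1) = 0 := by
      rw [hu]; simp
    refine hz.le.trans ?_
    have ha := alpha_nonneg 1
    have : 0 ≤ 1 - Real.exp (-ε / ((1:ℕ) * vol (unitBall 1))) := by
      have := Real.exp_le_one_iff.2 (neg_nonpos.2 ht0)
      rw [← neg_div] at this
      linarith
    positivity
  · obtain ⟨m, rfl⟩ : ∃ m, n = m + 1 := ⟨n - 1, by omega⟩
    obtain ⟨A, hA, hmain⟩ := main_bound (m := m)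
    have hα := alpha_pos h2
    set V := vol (unitBall (m+1)) with hV
    set α := alphaConst (m+1) with hαd
    set C := max 1 (A * α / (2 * (m+1:ℕ) * V)) with hC
    have hC1 : 1 ≤ C := le_max_left _ _
    have hC2 : A * α / (2 * (m+1:ℕ) * V) ≤ C := le_max_right _ _
    refine ⟨C, by linarith, fun K hK hVK ε hε e he hmin => ?_⟩
    obtain ⟨hε0, hb⟩ := hmain K hK ε hε e he (int_sq_le h2 hK hVK hmin)
    rw [sph_univ hn] at hb
    have ht0 : 0 ≤ ε / ((m+1:ℕ) * V) := by positivity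
    refine ⟨1, le_rfl, Real.one_le_exp ht0, ?_⟩
    refine hdist_pow_le hK e fun u => (hb u).trans ?_
    have e1 : ((m:ℝ) + 2) * (ε / ((m+1:ℕ) * V)) = (((m+1:ℕ):ℝ) + 1) * ε / ((m+1:ℕ) * V) := by
      push_cast; ring
    have e2 : -(ε / ((m+1:ℕ) * V)) = -ε / ((m+1:ℕ) * V) := by rw [neg_div]
    rw [← hV, e1, e2]
    have hlow : 0 ≤ 1 - Real.exp (-ε / ((m+1:ℕ) * V)) := by
      have := Real.exp_le_one_iff.2 (neg_nonpos.2 ht0)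
      rw [e2] at this
      linarith
    have hcoef : A ≤ 2 * (m+1:ℕ) * C ^ 2 * (C + 2) ^ (m + 1 - 1) * V / α := by
      rw [div_le_iff₀ (by positivity)] at hC2
      rw [le_div_iff₀ hα]
      refine hC2.trans ?_
      have h3 : 1 ≤ (C + 2) ^ (m + 1 - 1) := one_le_pow₀ (by linarith)
      have h4 : C ≤ C ^ 2 * (C + 2) ^ (m + 1 - 1) := by nlinarith [sq_nonneg C]
      calc C * (2 * (m+1:ℕ) * V) ≤ (C ^ 2 * (C + 2) ^ (m + 1 - 1)) * (2 * (m+1:ℕ) * V) := by gcongr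
        _ = _ := by ring
    gcongr
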